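/- arXiv:1909.11546 — 7 statements merged into one kernel-verified Lean document; each statement's English description precedes it below -/
import Mathlib

section
/- Let a : ℕ → ℚ satisfy a linear recurrence with constant rational coefficients: there exist L ≥ 1 and c_1, …, c_L ∈ ℚ with a(n) = c_1 a(n−1) + ⋯ + c_L a(n−L) for all n ≥ L. Suppose moreover there exist constants C > 0 and 0 < r < 1 such that |a(k)| ≤ C·r^k for all k ≥ 0. Then the series Σ_{k=0}^∞ a(k)² converges and its sum is a rational number. -/
open Filter Topology in
/-- A finite-dimensional shift-invariant space of sequences tending to zero is closed under
taking telescoping primitives. -/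
theorem exists_mem_sub_shift_eq {P : Submodule ℚ (ℕ → ℚ)} [FiniteDimensional ℚ P]
    (hshift : ∀ f ∈ P, (fun n => f (n + 1)) ∈ P)
    (hzero : ∀ f ∈ P, Tendsto f atTop (𝓝 0)) {g : ℕ → ℚ} (hg : g ∈ P) :
    ∃ f ∈ P, ∀ n, f n - f (n + 1) = g n := by
  let S : (ℕ → ℚ) →ₗ[ℚ] (ℕ → ℚ) := LinearMap.id - LinearMap.funLeft ℚ ℚ Nat.succ
  have hS : ∀ f ∈ P, S f ∈ P := fun f hf => P.sub_mem hf (hshift f hf)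
  have hinj : Function.Injective (S.restrict hS) := by
    rw [← LinearMap.ker_eq_bot, LinearMap.ker_eq_bot']
    rintro ⟨f, hf⟩ h
    have hstep (n : ℕ) : f n = f (n + 1) :=
      sub_eq_zero.mp (congrFun (congrArg Subtype.val h) n)
    have hconst (n : ℕ) : f n = f 0 := by
      induction n with
      | zero => rfl
      | succ n ih => rw [← hstep, ih]
    have h0 : f 0 = 0 :=
      tendsto_nhds_unique (tendsto_const_nhds.congr fun n => (hconst n).symm) (hzero f hf)
    ext n
    exact (hconst n).trans h0
  obtain ⟨⟨f, hf⟩, h⟩ := LinearMap.injective_iff_surjective.mp hinj ⟨g, hg⟩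
  exact ⟨f, hf, fun n => congrFun (congrArg Subtype.val h) n⟩

open Filter Topology in
/-- The square of a linearly recurrent rational sequence tending to zero has a telescoping
primitive tending to zero. -/
theorem LinearRecurrence.IsSolution.exists_sub_shift_eq_sq {E : LinearRecurrence ℚ} {a : ℕ → ℚ}
    (ha : E.IsSolution a) (ha0 : Tendsto a atTop (𝓝 0)) :
    ∃ f : ℕ → ℚ, Tendsto f atTop (𝓝 0) ∧ ∀ n, f n - f (n + 1) = a n ^ 2 := by
  let Z : Submodule ℚ (ℕ → ℚ) :=
    { carrier := {f | Tendsto f atTop (𝓝 0)}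
      add_mem' := fun {f g} hf hg => (Tendsto.add hf hg).mono_right (by rw [add_zero])
      zero_mem' := tendsto_const_nhds
      smul_mem' := fun c f hf => (Tendsto.const_mul c hf).mono_right (by rw [mul_zero]) }
  let W := E.solSpace ⊓ Z
  have : FiniteDimensional ℚ E.solSpace := E.toInit.symm.finiteDimensional
  have : FiniteDimensional ℚ W := Submodule.finiteDimensional_of_le inf_le_left
  have hWfg : W.FG := Module.Finite.iff_fg.mp this
  have : FiniteDimensional ℚ (W * W : Submodule ℚ (ℕ → ℚ)) :=
    Module.Finite.iff_fg.mpr (hWfg.mul hWfg)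
  have hWshift : ∀ f ∈ W, (fun n => f (n + 1)) ∈ W := by
    rintro f ⟨hf, hf0⟩
    refine ⟨fun n => ?_, (tendsto_add_atTop_iff_nat 1).mpr hf0⟩
    simpa only [add_right_comm] using hf (n + 1)
  have hzero : ∀ f ∈ W * W, Tendsto f atTop (𝓝 0) := by
    intro f hf
    induction hf using Submodule.mul_induction_on' with
    | mem_mul_mem u hu v hv => exact (Tendsto.mul hu.2 hv.2).mono_right (by rw [mul_zero])
    | add u _ v _ hu hv => exact Z.add_mem hu hv
  have hshift : ∀ f ∈ W * W, (fun n => f (n + 1)) ∈ W * W := by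
    intro f hf
    induction hf using Submodule.mul_induction_on' with
    | mem_mul_mem u hu v hv => exact Submodule.mul_mem_mul (hWshift u hu) (hWshift v hv)
    | add u _ v _ hu hv => exact Submodule.add_mem _ hu hv
  have haW : a ∈ W := ⟨ha, ha0⟩
  obtain ⟨f, hf, h⟩ := exists_mem_sub_shift_eq hshift hzero (Submodule.mul_mem_mul haW haW)
  exact ⟨f, hzero f hf, fun n => by rw [h, Pi.mul_apply, sq]⟩

/-- If a : ℕ → ℚ satisfies a linear recurrence with constant rational
coefficients (a(n) = c₁ a(n-1) + ⋯ + c_L a(n-L) for n ≥ L) and |a(k)| ≤ C·r^k with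
0 < r < 1, then Σ a(k)² converges to a rational number. -/
theorem sum_of_squares_of_C_recursive_is_rational (a : ℕ → ℚ)
    (L : ℕ) (hL : 1 ≤ L) (c : Fin L → ℚ)
    (hrec : ∀ n : ℕ, L ≤ n → a n = ∑ i : Fin L, c i * a (n - ((i : ℕ) + 1)))
    (C r : ℝ) (hC : 0 < C) (hr0 : 0 < r) (hr1 : r < 1)
    (hbound : ∀ k : ℕ, |(a k : ℝ)| ≤ C * r ^ k) :
    ∃ q : ℚ, HasSum (fun k : ℕ => ((a k : ℝ)) ^ 2) (q : ℝ) := by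
  have ha : LinearRecurrence.IsSolution ⟨L, fun i => c i.rev⟩ a := by
    intro n
    change a (n + L) = ∑ i : Fin L, c i.rev * a (n + i)
    rw [hrec (n + L) (Nat.le_add_left L n), ← Equiv.sum_comp Fin.revPerm]
    refine Finset.sum_congr rfl fun i _ => ?_
    have hi : n + L - ((i.rev : ℕ) + 1) = n + i := by
      rw [Fin.val_rev]
      omega
    rw [Fin.revPerm_apply, hi]
  have ha0 : Filter.Tendsto a Filter.atTop (nhds 0) := by
    rw [Rat.isUniformEmbedding_coe_real.isInducing.tendsto_nhds_iff, Rat.cast_zero]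
    exact squeeze_zero_norm hbound
      (by simpa using (tendsto_pow_atTop_nhds_zero_of_lt_one hr0.le hr1).const_mul C)
  obtain ⟨f, hf0, hf⟩ := ha.exists_sub_shift_eq_sq ha0
  refine ⟨f 0, (hasSum_iff_tendsto_nat_of_nonneg (fun k => sq_nonneg _) _).mpr ?_⟩
  have hsum (n : ℕ) : ∑ k ∈ Finset.range n, (a k : ℝ) ^ 2 = ((f 0 - f n : ℚ) : ℝ) := by
    rw [← Finset.sum_range_sub', Rat.cast_sum]
    exact Finset.sum_congr rfl fun k _ => by rw [hf, Rat.cast_pow]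
  simp_rw [hsum]
  exact (Rat.continuous_coe_real.tendsto _).comp (by simpa using hf0.const_sub (f 0))
end

section
/- Let a positive-step die be given with rational probabilities: face values v_1, …, v_s (positive integers) and p_1, …, p_s ∈ ℚ, each p_j > 0, summing to 1. For n ≥ 1 let b_n(k) ∈ ℚ be the first-passage probability P_n(k) and set a(n) = Σ_{k=1}^{n} b_n(k)². Then the sequence a(n) is P-recursive: there exist L ≥ 1 and polynomials q_0, …, q_L with rational coefficients, not all zero, such that q_0(n)·a(n) + q_1(n)·a(n−1) + ⋯ + q_L(n)·a(n−L) = 0 for all n > L. -/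
/-- The sum of the first `j` steps of the word `w` (face values given by `v`). -/
def prefSumN {s k : ℕ} (v : Fin s → ℕ) (w : Fin k → Fin s) (j : ℕ) : ℕ :=
  ∑ i ∈ Finset.univ.filter (fun i : Fin k => (i : ℕ) < j), v (w i)

/-- The first-passage probability `P_n(k)` (rational version): the probability that the
running total of rolls of the die (face values `v`, rational probabilities `p`) first
reaches `≥ n` at exactly roll `k`. -/
def firstPassageQ {s : ℕ} (v : Fin s → ℕ) (p : Fin s → ℚ) (n k : ℕ) : ℚ :=
  ∑ w ∈ Finset.univ.filter (fun w : Fin k → Fin s =>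
      n ≤ prefSumN v w k ∧ ∀ j : ℕ, j < k → prefSumN v w j < n),
    ∏ i : Fin k, p (w i)

/-- `a(n) = Σ_{k=1}^n P_n(k)²`, so that `(1 + a(n))/2` is the first player's winning
probability in the two-player race to `n`. -/
def sumSq {s : ℕ} (v : Fin s → ℕ) (p : Fin s → ℚ) (n : ℕ) : ℚ :=
  ∑ k ∈ Finset.Icc 1 n, (firstPassageQ v p n k) ^ 2

open MvPowerSeries in
/-- The derivation of the power series ring multiplying the coefficient of exponent `m` by
the additive weight `w m`. -/
noncomputable def weightDerivation {σ : Type*} (w : (σ →₀ ℕ) →+ ℚ) :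
    Derivation ℚ (MvPowerSeries σ ℚ) (MvPowerSeries σ ℚ) :=
  Derivation.mk'
    { toFun := fun φ m => w m * coeff m φ
      map_add' := fun φ ψ => by
        ext m
        simp only [coeff_apply, map_add]
        exact mul_add _ _ _
      map_smul' := fun r φ => by
        ext m
        change w m * (r * coeff m φ) = r * (w m * coeff m φ)
        ring }
    (fun φ ψ => by
      classical
      ext m
      change w m * coeff m (φ * ψ) = coeff m (φ * _ + ψ * _)
      rw [map_add, mul_comm ψ, coeff_mul, coeff_mul, coeff_mul, Finset.mul_sum,
        ← Finset.sum_add_distrib]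
      refine Finset.sum_congr rfl fun x hx => ?_
      rw [← Finset.HasAntidiagonal.mem_antidiagonal.mp hx, map_add]
      change _ = _ * (w x.2 * coeff x.2 ψ) + (w x.1 * coeff x.1 φ) * _
      ring)

theorem coeff_weightDerivation {σ : Type*} (w : (σ →₀ ℕ) →+ ℚ) (φ : MvPowerSeries σ ℚ)
    (m : σ →₀ ℕ) :
    MvPowerSeries.coeff m (weightDerivation w φ) = w m * MvPowerSeries.coeff m φ := rfl

/-- The weight of an exponent given by its coordinate at `s`. -/
noncomputable def coordWeight (s : Fin 2) : (Fin 2 →₀ ℕ) →+ ℚ :=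
  (Nat.castAddMonoidHom ℚ).comp (Finsupp.applyAddHom s)

theorem coordWeight_apply (s : Fin 2) (m : Fin 2 →₀ ℕ) : coordWeight s m = (m s : ℚ) := rfl

/-- The exponent of the monomial `x ^ i * z ^ j`. -/
noncomputable def biexp (i j : ℕ) : Fin 2 →₀ ℕ := Finsupp.single 0 i + Finsupp.single 1 j

@[simp] theorem biexp_zero (i j : ℕ) : biexp i j 0 = i := by simp [biexp]

@[simp] theorem biexp_one (i j : ℕ) : biexp i j 1 = j := by simp [biexp]

theorem biexp_eta (m : Fin 2 →₀ ℕ) : biexp (m 0) (m 1) = m := by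
  ext s
  fin_cases s <;> simp

theorem biexp_inj {i j k l : ℕ} : biexp i j = biexp k l ↔ i = k ∧ j = l := by
  refine ⟨fun h => ⟨?_, ?_⟩, fun h => by rw [h.1, h.2]⟩
  · simpa using DFunLike.congr_fun h 0
  · simpa using DFunLike.congr_fun h 1

theorem biexp_add (i j k l : ℕ) : biexp (i + k) (j + l) = biexp i j + biexp k l := by
  ext s
  fin_cases s <;> simp

open MvPowerSeries in
/-- The coefficient of `x ^ i * z ^ j` in `u(x) * w(z)`. -/
theorem coeff_aeval_mul_aeval (u w : Polynomial ℚ) (i j : ℕ) :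
    coeff (biexp i j) (Polynomial.aeval (X 0 : MvPowerSeries (Fin 2) ℚ) u *
      Polynomial.aeval (X 1 : MvPowerSeries (Fin 2) ℚ) w) = u.coeff i * w.coeff j := by
  classical
  induction u using Polynomial.induction_on' with
  | add p q hp hq => rw [map_add, add_mul, map_add, hp, hq, Polynomial.coeff_add, add_mul]
  | monomial a r =>
    induction w using Polynomial.induction_on' with
    | add p q hp hq => rw [map_add, mul_add, map_add, hp, hq, Polynomial.coeff_add, mul_add]
    | monomial b t =>
      rw [Polynomial.aeval_monomial, Polynomial.aeval_monomial, X_pow_eq, X_pow_eq,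
        mul_mul_mul_comm, monomial_mul_monomial, ← map_mul, ← Algebra.smul_def,
        LinearMap.map_smul, coeff_monomial, Polynomial.coeff_monomial, Polynomial.coeff_monomial]
      change _ • (if biexp i j = biexp a b then _ else _) = _
      simp only [biexp_inj, @eq_comm _ i, @eq_comm _ j]
      by_cases h1 : a = i <;> by_cases h2 : b = j <;> simp [h1, h2]

open MvPowerSeries in
/-- Polynomials in two variables of degree at most `D` in each variable. -/
noncomputable def bidegLE (D : ℕ) : Submodule ℚ (MvPowerSeries (Fin 2) ℚ) where
  carrier := {P | ∀ m : Fin 2 →₀ ℕ, (∃ s, D < m s) → coeff m P = 0}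
  add_mem' := fun hP hQ m hm => by rw [map_add, hP m hm, hQ m hm, add_zero]
  zero_mem' := fun m _ => by simp
  smul_mem' := fun c P hP m hm => by rw [LinearMap.map_smul, hP m hm, smul_zero]

theorem bidegLE_mono {D D' : ℕ} (h : D ≤ D') : bidegLE D ≤ bidegLE D' :=
  fun _ hP m ⟨s, hs⟩ => hP m ⟨s, h.trans_lt hs⟩

theorem mul_mem_bidegLE {D E : ℕ} {P Q : MvPowerSeries (Fin 2) ℚ} (hP : P ∈ bidegLE D)
    (hQ : Q ∈ bidegLE E) : P * Q ∈ bidegLE (D + E) := by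
  classical
  rintro m ⟨s, hs⟩
  rw [MvPowerSeries.coeff_mul]
  refine Finset.sum_eq_zero fun x hx => ?_
  have hx' : x.1 s + x.2 s = m s := by
    rw [← Finset.HasAntidiagonal.mem_antidiagonal.mp hx, Finsupp.add_apply]
  rcases lt_or_ge D (x.1 s) with h | h
  · rw [hP _ ⟨s, h⟩, zero_mul]
  · rw [hQ _ ⟨s, by omega⟩, mul_zero]

theorem weightDerivation_mem_bidegLE {D : ℕ} (w : (Fin 2 →₀ ℕ) →+ ℚ)
    {P : MvPowerSeries (Fin 2) ℚ} (hP : P ∈ bidegLE D) : weightDerivation w P ∈ bidegLE D :=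
  fun m hm => by rw [coeff_weightDerivation, hP m hm, mul_zero]

theorem X_mem_bidegLE (s : Fin 2) : (MvPowerSeries.X s : MvPowerSeries (Fin 2) ℚ) ∈ bidegLE 1 := by
  classical
  rintro m ⟨t, ht⟩
  rw [MvPowerSeries.coeff_X, if_neg]
  rintro rfl
  have := Finsupp.single_apply (a := s) (a' := t) (b := 1)
  split_ifs at this <;> omega

theorem one_mem_bidegLE (D : ℕ) : (1 : MvPowerSeries (Fin 2) ℚ) ∈ bidegLE D := by
  classical
  rintro m ⟨t, ht⟩
  rw [MvPowerSeries.coeff_one, if_neg]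
  rintro rfl
  simp at ht

theorem aeval_mul_aeval_mem_bidegLE {u w : Polynomial ℚ} {D : ℕ} (hu : u.natDegree ≤ D)
    (hw : w.natDegree ≤ D) :
    Polynomial.aeval (MvPowerSeries.X 0 : MvPowerSeries (Fin 2) ℚ) u *
      Polynomial.aeval (MvPowerSeries.X 1 : MvPowerSeries (Fin 2) ℚ) w ∈ bidegLE D := by
  rintro m ⟨s, hs⟩
  rw [← biexp_eta m, coeff_aeval_mul_aeval]
  fin_cases s
  · change D < m 0 at hs
    rw [Polynomial.coeff_eq_zero_of_natDegree_lt (hu.trans_lt hs), zero_mul]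
  · change D < m 1 at hs
    rw [Polynomial.coeff_eq_zero_of_natDegree_lt (hw.trans_lt hs), mul_zero]

/-- A polynomial of bounded bidegree is determined by finitely many coefficients. -/
noncomputable def bidegLECoeffs (D : ℕ) : bidegLE D →ₗ[ℚ] (Fin (D + 1) × Fin (D + 1) → ℚ) :=
  LinearMap.pi fun x => (MvPowerSeries.coeff (biexp x.1 x.2)).comp (bidegLE D).subtype

theorem bidegLECoeffs_injective (D : ℕ) : Function.Injective (bidegLECoeffs D) := by
  rw [injective_iff_map_eq_zero]
  rintro ⟨P, hP⟩ h
  ext m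
  change MvPowerSeries.coeff m P = 0
  by_cases hm : ∃ s, D < m s
  · exact hP m hm
  · push Not at hm
    have := congrFun h (⟨m 0, Nat.lt_succ_of_le (hm 0)⟩, ⟨m 1, Nat.lt_succ_of_le (hm 1)⟩)
    rw [← biexp_eta m]
    exact this

instance (D : ℕ) : Module.Finite ℚ (bidegLE D) :=
  Module.Finite.of_injective _ (bidegLECoeffs_injective D)

theorem finrank_bidegLE_le (D : ℕ) : Module.finrank ℚ (bidegLE D) ≤ (D + 1) ^ 2 := by
  have := LinearMap.finrank_le_finrank_of_injective (bidegLECoeffs_injective D)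
  simpa [sq] using this

/-- The multiples of `U ^ M` by polynomials of bidegree at most `D`. -/
noncomputable def bidegLEMulPow (U : MvPowerSeries (Fin 2) ℚ) (M D : ℕ) :
    Submodule ℚ (MvPowerSeries (Fin 2) ℚ) :=
  (bidegLE D).map (LinearMap.mulRight ℚ (U ^ M))

theorem mem_bidegLEMulPow {U Y : MvPowerSeries (Fin 2) ℚ} {M D : ℕ} :
    Y ∈ bidegLEMulPow U M D ↔ ∃ P ∈ bidegLE D, P * U ^ M = Y := Iff.rfl

instance (U : MvPowerSeries (Fin 2) ℚ) (M D : ℕ) : Module.Finite ℚ (bidegLEMulPow U M D) :=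
  inferInstanceAs (Module.Finite ℚ ((bidegLE D).map _))

theorem finrank_bidegLEMulPow_le (U : MvPowerSeries (Fin 2) ℚ) (M D : ℕ) :
    Module.finrank ℚ (bidegLEMulPow U M D) ≤ (D + 1) ^ 2 :=
  (Submodule.finrank_map_le _ _).trans (finrank_bidegLE_le D)

theorem bidegLEMulPow_mono (U : MvPowerSeries (Fin 2) ℚ) (M : ℕ) {D E : ℕ} (h : D ≤ E) :
    bidegLEMulPow U M D ≤ bidegLEMulPow U M E :=
  Submodule.map_mono (bidegLE_mono h)

theorem mul_mem_bidegLEMulPow {U P Y : MvPowerSeries (Fin 2) ℚ} {M D E : ℕ}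
    (hP : P ∈ bidegLE E) (hY : Y ∈ bidegLEMulPow U M D) : P * Y ∈ bidegLEMulPow U M (D + E) := by
  obtain ⟨Q, hQ, rfl⟩ := mem_bidegLEMulPow.mp hY
  exact mem_bidegLEMulPow.mpr ⟨Q * P, mul_mem_bidegLE hQ hP, by ring⟩

theorem bidegLEMulPow_le_succ {U B : MvPowerSeries (Fin 2) ℚ} {h : ℕ} (hB : B ∈ bidegLE h)
    (hBU : B * U = 1) (M D : ℕ) : bidegLEMulPow U M D ≤ bidegLEMulPow U (M + 1) (D + h) := by
  intro Y hY
  obtain ⟨P, hP, rfl⟩ := mem_bidegLEMulPow.mp hY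
  refine mem_bidegLEMulPow.mpr ⟨P * B, mul_mem_bidegLE hP hB, ?_⟩
  calc P * B * U ^ (M + 1) = P * U ^ M * (B * U) := by ring
    _ = P * U ^ M := by rw [hBU, mul_one]

theorem weightDerivation_mem_bidegLEMulPow {U B : MvPowerSeries (Fin 2) ℚ} {h : ℕ}
    (hB : B ∈ bidegLE h) (hBU : B * U = 1) (w : (Fin 2 →₀ ℕ) →+ ℚ) {M D : ℕ}
    {Y : MvPowerSeries (Fin 2) ℚ} (hY : Y ∈ bidegLEMulPow U M D) :
    weightDerivation w Y ∈ bidegLEMulPow U (M + 1) (D + h) := by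
  obtain ⟨P, hP, rfl⟩ := mem_bidegLEMulPow.mp hY
  set δ := weightDerivation w
  have hU : δ U = -(U ^ 2 * δ B) := by
    have h1 : B * δ U + U * δ B = 0 := by
      have := δ.leibniz B U
      rw [hBU, Derivation.map_one_eq_zero] at this
      simpa using this.symm
    linear_combination U * h1 - δ U * hBU
  refine mem_bidegLEMulPow.mpr ⟨δ P * B - (M : ℚ) • (P * δ B), Submodule.sub_mem _
    (mul_mem_bidegLE (weightDerivation_mem_bidegLE w hP) hB)
    (Submodule.smul_mem _ _ (mul_mem_bidegLE hP (weightDerivation_mem_bidegLE w hB))), ?_⟩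
  rw [Derivation.leibniz, Derivation.leibniz_pow, hU]
  cases M with
  | zero =>
    simp
    linear_combination δ P * hBU
  | succ M =>
    simp only [smul_eq_mul, nsmul_eq_mul, Nat.add_sub_cancel, Algebra.smul_def, map_natCast]
    linear_combination δ P * U ^ (M + 1) * hBU

/-- The operator `z * (x * ∂/∂x - z * ∂/∂z - 1)`. -/
noncomputable def antidiagOp : Module.End ℚ (MvPowerSeries (Fin 2) ℚ) :=
  (LinearMap.mulLeft ℚ (MvPowerSeries.X 1)).comp
    ((weightDerivation (coordWeight 0 - coordWeight 1)).toLinearMap - LinearMap.id)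

/-- The operator `z * ∂/∂z`. -/
noncomputable def eulerOp : Module.End ℚ (MvPowerSeries (Fin 2) ℚ) :=
  (weightDerivation (coordWeight 1)).toLinearMap

/-- Multiplication by `x * z`. -/
noncomputable def diagShift : Module.End ℚ (MvPowerSeries (Fin 2) ℚ) :=
  LinearMap.mulLeft ℚ (MvPowerSeries.X 0 * MvPowerSeries.X 1)

theorem coeff_antidiagOp_zero (i : ℕ) (Y : MvPowerSeries (Fin 2) ℚ) :
    MvPowerSeries.coeff (biexp i 0) (antidiagOp Y) = 0 :=
  MvPowerSeries.X_dvd_iff.mp ⟨_, rfl⟩ _ (by simp)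

theorem coeff_antidiagOp_succ (i j : ℕ) (Y : MvPowerSeries (Fin 2) ℚ) :
    MvPowerSeries.coeff (biexp i (j + 1)) (antidiagOp Y) =
      ((i : ℚ) - j - 1) * MvPowerSeries.coeff (biexp i j) Y := by
  have : biexp i (j + 1) = Finsupp.single 1 1 + biexp i j := by
    simp only [biexp, Finsupp.single_add]; abel
  change MvPowerSeries.coeff _ (MvPowerSeries.X 1 * (weightDerivation _ Y - Y)) = _
  rw [this, MvPowerSeries.X_def, MvPowerSeries.coeff_add_monomial_mul, map_sub,
    coeff_weightDerivation, AddMonoidHom.sub_apply, coordWeight_apply, coordWeight_apply,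
    biexp_zero, biexp_one]
  ring

theorem coeff_antidiagOp_pow_of_lt {d c : ℕ} (h : d < c) (i : ℕ) (Y : MvPowerSeries (Fin 2) ℚ) :
    MvPowerSeries.coeff (biexp i (i + d)) ((antidiagOp ^ c) Y) = 0 := by
  obtain ⟨c, rfl⟩ : ∃ c', c = c' + 1 := ⟨c - 1, by omega⟩
  rw [pow_succ', Module.End.mul_apply]
  induction d generalizing c with
  | zero =>
    cases i with
    | zero => exact coeff_antidiagOp_zero _ _
    | succ i =>
      rw [add_zero, coeff_antidiagOp_succ]
      push_cast
      ring
  | succ d ih =>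
    obtain ⟨c, rfl⟩ : ∃ c', c = c' + 1 := ⟨c - 1, by omega⟩
    rw [← add_assoc, coeff_antidiagOp_succ, pow_succ', Module.End.mul_apply, ih c (by omega),
      mul_zero]

theorem coeff_antidiagOp_pow_self (c i : ℕ) (Y : MvPowerSeries (Fin 2) ℚ) :
    MvPowerSeries.coeff (biexp i (i + c)) ((antidiagOp ^ c) Y) =
      (-1) ^ c * (c.factorial : ℚ) * MvPowerSeries.coeff (biexp i i) Y := by
  induction c with
  | zero => simp
  | succ c ih =>
    rw [← add_assoc, pow_succ', Module.End.mul_apply, coeff_antidiagOp_succ, ih,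
      Nat.factorial_succ]
    push_cast
    ring

theorem coeff_eulerOp_pow (b i j : ℕ) (Y : MvPowerSeries (Fin 2) ℚ) :
    MvPowerSeries.coeff (biexp i j) ((eulerOp ^ b) Y) =
      (j : ℚ) ^ b * MvPowerSeries.coeff (biexp i j) Y := by
  induction b with
  | zero => simp
  | succ b ih =>
    rw [pow_succ', Module.End.mul_apply]
    change MvPowerSeries.coeff _ (weightDerivation _ _) = _
    rw [coeff_weightDerivation, ih, coordWeight_apply, biexp_one]
    ring

theorem coeff_diagShift_pow (a i j : ℕ) (Y : MvPowerSeries (Fin 2) ℚ) :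
    MvPowerSeries.coeff (biexp (a + i) (a + j)) ((diagShift ^ a) Y) =
      MvPowerSeries.coeff (biexp i j) Y := by
  rw [diagShift, LinearMap.pow_mulLeft, LinearMap.mulLeft_apply, mul_pow, MvPowerSeries.X_pow_eq,
    MvPowerSeries.X_pow_eq, MvPowerSeries.monomial_mul_monomial, biexp_add]
  change MvPowerSeries.coeff _ (MvPowerSeries.monomial (biexp a a) _ * _) = _
  rw [MvPowerSeries.coeff_add_monomial_mul]
  ring

theorem pow_apply_mem_of_step {V : Type*} [AddCommGroup V] [Module ℚ V] (K : ℕ → Submodule ℚ V)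
    (T : Module.End ℚ V) (hT : ∀ m, ∀ Y ∈ K m, T Y ∈ K (m + 1)) (c m : ℕ) {Y : V}
    (hY : Y ∈ K m) : (T ^ c) Y ∈ K (m + c) := by
  induction c with
  | zero => simpa
  | succ c ih =>
    rw [pow_succ', Module.End.mul_apply]
    exact hT _ _ ih

/-- Lipshitz's counting argument: a rational power series `A * U` is annihilated by a nonzero
combination of the operators `diagShift ^ a * eulerOp ^ b * antidiagOp ^ c`. -/
theorem exists_annihilating_operator {A U B : MvPowerSeries (Fin 2) ℚ} {h : ℕ}
    (hA : A ∈ bidegLE h) (hB : B ∈ bidegLE h) (hBU : B * U = 1) :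
    ∃ N : ℕ, 1 ≤ N ∧ ∃ l : Fin (N + 1) × Fin (N + 1) × Fin (N + 1) → ℚ,
      ∑ x, l x • (diagShift ^ (x.1 : ℕ)) ((eulerOp ^ (x.2.1 : ℕ))
        ((antidiagOp ^ (x.2.2 : ℕ)) (A * U))) = 0 ∧ ∃ x, l x ≠ 0 := by
  set K : ℕ → Submodule ℚ (MvPowerSeries (Fin 2) ℚ) :=
    fun m => bidegLEMulPow U (1 + m) (h + m * (h + 1)) with hK
  have hdeg : ∀ m, h + m * (h + 1) + h + 1 = h + (m + 1) * (h + 1) := fun m => by ring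
  have hincl : ∀ m, K m ≤ K (m + 1) := fun m =>
    (bidegLEMulPow_le_succ hB hBU _ _).trans
      (bidegLEMulPow_mono _ _ (by rw [← hdeg]; omega))
  have hmono : Monotone K := monotone_nat_of_le_succ hincl
  have hθ : ∀ w m, ∀ Y ∈ K m,
      weightDerivation w Y ∈ bidegLEMulPow U (1 + (m + 1)) (h + m * (h + 1) + h) :=
    fun w m Y hY => weightDerivation_mem_bidegLEMulPow hB hBU w hY
  have hE : ∀ m, ∀ Y ∈ K m, eulerOp Y ∈ K (m + 1) := fun m Y hY =>
    bidegLEMulPow_mono _ _ (by rw [← hdeg]; omega) (hθ _ m Y hY)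
  have hD : ∀ m, ∀ Y ∈ K m, antidiagOp Y ∈ K (m + 1) := fun m Y hY => by
    have := mul_mem_bidegLEMulPow (X_mem_bidegLE 1) (Submodule.sub_mem _
      (hθ (coordWeight 0 - coordWeight 1) m Y hY) (bidegLEMulPow_le_succ hB hBU _ _ hY))
    rw [hdeg] at this
    exact this
  have hS : ∀ m, ∀ Y ∈ K m, diagShift Y ∈ K (m + 1) := fun m Y hY => by
    have hXX : (MvPowerSeries.X 0 * MvPowerSeries.X 1 : MvPowerSeries (Fin 2) ℚ) ∈ bidegLE 1 := by
      have := aeval_mul_aeval_mem_bidegLE (u := Polynomial.X) (w := Polynomial.X) (D := 1)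
        (by simp) (by simp)
      simpa using this
    have := bidegLEMulPow_le_succ hB hBU _ _ (mul_mem_bidegLEMulPow hXX hY)
    exact bidegLEMulPow_mono _ _ (by rw [← hdeg]; omega) this
  have h0 : A * U ∈ K 0 := mem_bidegLEMulPow.mpr ⟨A, bidegLE_mono (by omega) hA, by simp⟩
  set C := 3 * (h + 1) + (h + 1) with hC
  refine ⟨C ^ 2, Nat.one_le_pow _ _ (by omega), ?_⟩
  set N := C ^ 2 with hN
  set f : Fin (N + 1) × Fin (N + 1) × Fin (N + 1) → K (3 * N) := fun x =>
    ⟨(diagShift ^ (x.1 : ℕ)) ((eulerOp ^ (x.2.1 : ℕ)) ((antidiagOp ^ (x.2.2 : ℕ)) (A * U))),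
      hmono (by omega) (pow_apply_mem_of_step K _ hS _ _ (pow_apply_mem_of_step K _ hE _ _
        (pow_apply_mem_of_step K _ hD _ _ h0)))⟩ with hf
  have hdep : ¬ LinearIndependent ℚ f := by
    intro hli
    have h1 := hli.fintype_card_le_finrank.trans (finrank_bidegLEMulPow_le _ _ _)
    simp only [Fintype.card_prod, Fintype.card_fin] at h1
    have h2 : h + 3 * N * (h + 1) + 1 ≤ C * (N + 1) := by
      rw [hC]; ring_nf; omega
    have h3 := h1.trans (Nat.pow_le_pow_left h2 2)
    rw [mul_pow, ← hN] at h3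
    nlinarith [Nat.pos_of_ne_zero (Nat.succ_ne_zero N)]
  obtain ⟨l, hl, hne⟩ := Fintype.not_linearIndependent_iff.mp hdep
  refine ⟨l, ?_, hne⟩
  have := congrArg Subtype.val hl
  simpa [hf] using this

theorem sum_smul_X_add_C_pow_ne_zero {N : ℕ} {l : Fin (N + 1) → ℚ} (hl : ∃ b, l b ≠ 0) (r : ℚ) :
    ∑ b, Polynomial.C (l b) * (Polynomial.X + Polynomial.C r) ^ (b : ℕ) ≠ 0 := by
  intro h
  obtain ⟨b, hb⟩ := hl
  have h1 := congrArg (fun P => (Polynomial.compRingHom (Polynomial.X - Polynomial.C r) P).coeff b) h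
  simp only [map_sum, map_zero, Polynomial.coe_compRingHom_apply, Polynomial.mul_comp, Polynomial.C_comp,
    Polynomial.pow_comp, Polynomial.add_comp, Polynomial.X_comp, sub_add_cancel,
    Polynomial.finsetSum_coeff, Polynomial.coeff_C_mul, Polynomial.coeff_X_pow,
    Polynomial.coeff_zero, Fin.val_inj, mul_ite, mul_one, mul_zero,
    Finset.sum_ite_eq, Finset.mem_univ, if_true] at h1
  exact hb h1

/-- The diagonal of a rational power series in two variables is P-recursive. -/
theorem exists_recurrence_diagonal {A U B : MvPowerSeries (Fin 2) ℚ} {h : ℕ}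
    (hA : A ∈ bidegLE h) (hB : B ∈ bidegLE h) (hBU : B * U = 1) :
    ∃ N : ℕ, 1 ≤ N ∧ ∃ q : Fin (N + 1) → Polynomial ℚ, (∃ i, q i ≠ 0) ∧
      ∀ n : ℕ, N ≤ n → ∑ i : Fin (N + 1), (q i).eval (n : ℚ) *
        MvPowerSeries.coeff (biexp (n - i) (n - i)) (A * U) = 0 := by
  classical
  obtain ⟨N, hN, l, hl, x, hx⟩ := exists_annihilating_operator hA hB hBU
  obtain ⟨c, ⟨a₀, hc⟩, hmin⟩ := WellFounded.has_min wellFounded_lt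
    {c : Fin (N + 1) | ∃ a b, l (a, b, c) ≠ 0} ⟨x.2.2, x.1, x.2.1, hx⟩
  have hzero : ∀ c' < c, ∀ a b, l (a, b, c') = 0 := fun c' hc' a b => by
    by_contra hne
    exact hmin c' ⟨a, b, hne⟩ hc'
  refine ⟨N, hN, fun a => ∑ b, Polynomial.C (l (a, b, c)) *
    (Polynomial.X + Polynomial.C ((c : ℚ) - (a : ℕ))) ^ (b : ℕ),
    ⟨a₀, sum_smul_X_add_C_pow_ne_zero hc _⟩, fun n hn => ?_⟩
  have key := congrArg (MvPowerSeries.coeff (biexp n (n + c))) hl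
  rw [map_sum, map_zero, Fintype.sum_prod_type] at key
  have hfac : ((-1) ^ (c : ℕ) * ((c : ℕ).factorial : ℚ)) ≠ 0 :=
    mul_ne_zero (pow_ne_zero _ (by norm_num)) (by exact_mod_cast Nat.factorial_ne_zero _)
  refine (mul_eq_zero.mp ?_).resolve_left hfac
  rw [← key, Finset.mul_sum]
  refine Finset.sum_congr rfl fun a _ => ?_
  rw [Fintype.sum_prod_type, Polynomial.eval_finsetSum, Finset.sum_mul, Finset.mul_sum]
  refine Finset.sum_congr rfl fun b _ => ?_
  have hterm : ∀ c' : Fin (N + 1), MvPowerSeries.coeff (biexp n (n + c))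
      ((diagShift ^ (a : ℕ)) ((eulerOp ^ (b : ℕ)) ((antidiagOp ^ (c' : ℕ)) (A * U)))) =
      ((n : ℚ) + (c - (a : ℕ))) ^ (b : ℕ) * MvPowerSeries.coeff (biexp (n - a) (n - a + c))
        ((antidiagOp ^ (c' : ℕ)) (A * U)) := fun c' => by
    have han : (a : ℕ) ≤ n := by omega
    conv_lhs => rw [show n + (c : ℕ) = a + (n - a + c) by omega]
    conv_lhs => rw [show biexp n = biexp (a + (n - a)) by rw [Nat.add_sub_cancel' han]]
    rw [coeff_diagShift_pow, coeff_eulerOp_pow, Nat.cast_add, Nat.cast_sub han]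
    ring
  rw [Finset.sum_eq_single c]
  · rw [LinearMap.map_smul, hterm, coeff_antidiagOp_pow_self]
    simp only [Polynomial.eval_mul, Polynomial.eval_C, Polynomial.eval_pow, Polynomial.eval_add,
      Polynomial.eval_X, smul_eq_mul]
    ring
  · intro c' _ hne
    rw [LinearMap.map_smul, hterm]
    rcases lt_or_gt_of_ne hne with hlt | hlt
    · rw [hzero c' hlt, zero_smul]
    · rw [coeff_antidiagOp_pow_of_lt hlt, mul_zero, smul_zero]
  · simp

open MvPowerSeries in
/-- If `f` has no constant term, the diagonal coefficients of `g(x) g(z) / (1 - f(x) f(z))` are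
sums of squares of coefficients of `g * f ^ k`. -/
theorem coeff_diagonal_eq_sum_sq {f g : Polynomial ℚ} (hf : f.coeff 0 = 0)
    {U : MvPowerSeries (Fin 2) ℚ}
    (hU : (1 - Polynomial.aeval (X 0 : MvPowerSeries (Fin 2) ℚ) f *
      Polynomial.aeval (X 1 : MvPowerSeries (Fin 2) ℚ) f) * U = 1) (n : ℕ) :
    coeff (biexp n n) ((Polynomial.aeval (X 0 : MvPowerSeries (Fin 2) ℚ) g *
      Polynomial.aeval (X 1 : MvPowerSeries (Fin 2) ℚ) g) * U) =
    ∑ k ∈ Finset.range (n + 1), ((g * f ^ k).coeff n) ^ 2 := by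
  set F := Polynomial.aeval (X 0 : MvPowerSeries (Fin 2) ℚ) f *
    Polynomial.aeval (X 1 : MvPowerSeries (Fin 2) ℚ) f with hF
  set G := Polynomial.aeval (X 0 : MvPowerSeries (Fin 2) ℚ) g *
    Polynomial.aeval (X 1 : MvPowerSeries (Fin 2) ℚ) g with hG
  have hgeom : G * U = ∑ k ∈ Finset.range (n + 1), G * F ^ k + F ^ (n + 1) * (G * U) := by
    rw [← Finset.mul_sum]
    linear_combination (-(G * U)) * mul_neg_geom_sum F (n + 1) +
      (G * ∑ k ∈ Finset.range (n + 1), F ^ k) * hU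
  have hterm : ∀ k, G * F ^ k = Polynomial.aeval (X 0 : MvPowerSeries (Fin 2) ℚ) (g * f ^ k) *
      Polynomial.aeval (X 1 : MvPowerSeries (Fin 2) ℚ) (g * f ^ k) := fun k => by
    simp only [hF, hG, map_mul, map_pow]
    ring
  have hdvd : (X 0 : MvPowerSeries (Fin 2) ℚ) ^ (n + 1) ∣ F ^ (n + 1) * (G * U) := by
    obtain ⟨f', rfl⟩ := Polynomial.X_dvd_iff.mpr hf
    refine Dvd.dvd.mul_right (pow_dvd_pow_of_dvd ?_ _) _
    rw [hF, map_mul, Polynomial.aeval_X, mul_assoc]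
    exact dvd_mul_right _ _
  rw [hgeom, map_add, X_pow_dvd_iff.mp hdvd _ (by simp), add_zero, map_sum]
  refine Finset.sum_congr rfl fun k _ => ?_
  rw [hterm, coeff_aeval_mul_aeval, sq]

/-- The generating polynomial of a roll of the die. -/
noncomputable def stepPoly {s : ℕ} (v : Fin s → ℕ) (p : Fin s → ℚ) : Polynomial ℚ :=
  ∑ j, Polynomial.monomial (v j) (p j)

/-- The generating polynomial of the tail probabilities of a roll of the die. -/
noncomputable def tailPoly {s : ℕ} (v : Fin s → ℕ) (p : Fin s → ℚ) : Polynomial ℚ :=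
  ∑ j, ∑ l ∈ Finset.range (v j), Polynomial.monomial l (p j)

theorem stepPoly_pow {s : ℕ} (v : Fin s → ℕ) (p : Fin s → ℚ) (k : ℕ) :
    stepPoly v p ^ k =
      ∑ w : Fin k → Fin s, Polynomial.monomial (∑ i, v (w i)) (∏ i, p (w i)) := by
  rw [stepPoly, Fintype.sum_pow]
  refine Finset.sum_congr rfl fun w _ => ?_
  simp only [← Polynomial.C_mul_X_pow_eq_monomial, Finset.prod_mul_distrib, map_prod,
    Finset.prod_pow_eq_pow_sum]

theorem sum_range_ite_add_eq (m S n : ℕ) (r : ℚ) :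
    ∑ l ∈ Finset.range m, (if l + S = n then r else 0) =
      if n + 1 ≤ S + m ∧ S < n + 1 then r else 0 := by
  split_ifs with h
  · rw [Finset.sum_eq_single (n - S)]
    · rw [if_pos (by omega)]
    · intro b _ hb
      rw [if_neg (by omega)]
    · intro hn
      rw [Finset.mem_range] at hn
      omega
  · refine Finset.sum_eq_zero fun l hl => if_neg ?_
    rw [Finset.mem_range] at hl
    omega

theorem prefSumN_mono {s k : ℕ} (v : Fin s → ℕ) (w : Fin k → Fin s) : Monotone (prefSumN v w) :=
  fun _ _ hij => Finset.sum_le_sum_of_subset fun _ hx => by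
    rw [Finset.mem_filter] at hx ⊢
    exact ⟨hx.1, hx.2.trans_le hij⟩

theorem prefSumN_snoc {s k : ℕ} (v : Fin s → ℕ) (w : Fin k → Fin s) (j : Fin s) :
    prefSumN v (Fin.snoc w j : Fin (k + 1) → Fin s) k = ∑ i, v (w i) := by
  rw [prefSumN, Finset.sum_filter, Fin.sum_univ_castSucc]
  simp

theorem prefSumN_snoc_succ {s k : ℕ} (v : Fin s → ℕ) (w : Fin k → Fin s) (j : Fin s) :
    prefSumN v (Fin.snoc w j : Fin (k + 1) → Fin s) (k + 1) = ∑ i, v (w i) + v j := by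
  rw [prefSumN, Finset.sum_filter, Fin.sum_univ_castSucc]
  simp

theorem firstPassageQ_succ_succ {s : ℕ} (v : Fin s → ℕ) (p : Fin s → ℚ) (n k : ℕ) :
    firstPassageQ v p (n + 1) (k + 1) = (tailPoly v p * stepPoly v p ^ k).coeff n := by
  rw [stepPoly_pow, tailPoly, Finset.sum_mul_sum, Polynomial.finsetSum_coeff, firstPassageQ,
    Finset.sum_filter, ← (Fin.snocEquiv fun _ : Fin (k + 1) => Fin s).sum_comp,
    Fintype.sum_prod_type]
  refine Finset.sum_congr rfl fun j _ => ?_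
  rw [Polynomial.finsetSum_coeff]
  refine Finset.sum_congr rfl fun w _ => ?_
  rw [Finset.sum_mul, Polynomial.finsetSum_coeff]
  simp only [Polynomial.monomial_mul_monomial, Polynomial.coeff_monomial]
  rw [sum_range_ite_add_eq]
  change (if n + 1 ≤ prefSumN v (Fin.snoc w j : Fin (k + 1) → Fin s) (k + 1) ∧
    ∀ i, i < k + 1 → prefSumN v (Fin.snoc w j : Fin (k + 1) → Fin s) i < n + 1 then
    ∏ i, p ((Fin.snoc w j : Fin (k + 1) → Fin s) i) else 0) = _
  have hiff : (∀ i, i < k + 1 → prefSumN v (Fin.snoc w j : Fin (k + 1) → Fin s) i < n + 1) ↔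
      ∑ i, v (w i) < n + 1 := by
    rw [← prefSumN_snoc v w j]
    exact ⟨fun h => h k k.lt_succ_self,
      fun h i hi => (prefSumN_mono v _ (Nat.lt_succ_iff.mp hi)).trans_lt h⟩
  simp only [hiff, prefSumN_snoc_succ, Fin.prod_univ_castSucc, Fin.snoc_castSucc, Fin.snoc_last, mul_comm]

theorem sumSq_succ {s : ℕ} (v : Fin s → ℕ) (p : Fin s → ℚ) (n : ℕ) :
    sumSq v p (n + 1) =
      ∑ k ∈ Finset.range (n + 1), ((tailPoly v p * stepPoly v p ^ k).coeff n) ^ 2 := by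
  rw [sumSq, ← Finset.Ico_add_one_right_eq_Icc, Finset.sum_Ico_eq_sum_range]
  refine Finset.sum_congr rfl fun k _ => ?_
  rw [add_comm 1 k, firstPassageQ_succ_succ]

theorem coeff_zero_stepPoly {s : ℕ} (v : Fin s → ℕ) (hv : ∀ j, 0 < v j) (p : Fin s → ℚ) :
    (stepPoly v p).coeff 0 = 0 := by
  rw [stepPoly, Polynomial.finsetSum_coeff]
  exact Finset.sum_eq_zero fun j _ => by
    rw [Polynomial.coeff_monomial, if_neg (hv j).ne']

/-- For a positive-step die with rational probabilities, the sequence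
`a(n) = Σ_{k=1}^n P_n(k)²` is P-recursive: it satisfies a linear recurrence with
polynomial coefficients, not all zero. -/
theorem sum_of_squares_first_passage_is_P_recursive (s : ℕ) (v : Fin s → ℕ)
    (hv : ∀ j, 0 < v j) (p : Fin s → ℚ) (hp : ∀ j, 0 < p j) (hp1 : ∑ j, p j = 1) :
    ∃ (L : ℕ), 1 ≤ L ∧ ∃ q : Fin (L + 1) → Polynomial ℚ,
      (∃ i, q i ≠ 0) ∧
      ∀ n : ℕ, L < n →
        ∑ i : Fin (L + 1), (q i).eval (n : ℚ) * sumSq v p (n - (i : ℕ)) = 0 := by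
  set f := stepPoly v p
  set g := tailPoly v p
  have hf : f.coeff 0 = 0 := coeff_zero_stepPoly v hv p
  set F := Polynomial.aeval (MvPowerSeries.X 0 : MvPowerSeries (Fin 2) ℚ) f *
    Polynomial.aeval (MvPowerSeries.X 1 : MvPowerSeries (Fin 2) ℚ) f with hF
  have hconst : MvPowerSeries.constantCoeff (1 - F) ≠ 0 := by
    have h0 : MvPowerSeries.coeff (biexp 0 0) F = 0 := by
      rw [hF, coeff_aeval_mul_aeval, hf, mul_zero]
    rw [show biexp 0 0 = 0 by simp [biexp], MvPowerSeries.coeff_zero_eq_constantCoeff_apply] at h0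
    rw [map_sub, map_one, h0]
    norm_num
  have hU := MvPowerSeries.mul_inv_cancel (1 - F) hconst
  have hB : 1 - F ∈ bidegLE (max f.natDegree g.natDegree) :=
    Submodule.sub_mem _ (one_mem_bidegLE _)
      (aeval_mul_aeval_mem_bidegLE (le_max_left _ _) (le_max_left _ _))
  obtain ⟨L, hL, q, ⟨i, hi⟩, hq⟩ := exists_recurrence_diagonal
    (aeval_mul_aeval_mem_bidegLE (le_max_right f.natDegree g.natDegree) (le_max_right _ _)) hB hU
  refine ⟨L, hL, fun i => (q i).comp (Polynomial.X - Polynomial.C 1), ⟨i, fun h => hi ?_⟩,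
    fun n hn => ?_⟩
  · have := congrArg (fun P => P.comp (Polynomial.X + Polynomial.C 1)) h
    simpa [Polynomial.comp_assoc] using this
  · obtain ⟨n, rfl⟩ : ∃ m, n = m + 1 := ⟨n - 1, by omega⟩
    rw [← hq n (by omega)]
    refine Finset.sum_congr rfl fun i _ => ?_
    rw [coeff_diagonal_eq_sum_sq hf hU, ← sumSq_succ,
      show n + 1 - (i : ℕ) = n - i + 1 by omega]
    simp
end

section
/- Let S be a finite set of integers and, for n ≥ 0, let a_S(n) be the number of words w = (w_1, …, w_n) with all entries in S whose total sum w_1 + ⋯ + w_n equals 0 and all of whose prefix sums w_1 + ⋯ + w_j (1 ≤ j ≤ n) are ≤ 0. Then the ordinary generating function f(t) = Σ_{n≥0} a_S(n) t^n, viewed as a formal power series over ℚ, is algebraic over the polynomial ring ℚ[t]: there exist d ≥ 1 and polynomials c_0(t), …, c_d(t) ∈ ℚ[t], not all zero, such that c_0(t) + c_1(t)·f(t) + ⋯ + c_d(t)·f(t)^d = 0 as formal power series. -/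
/-- `walkCount S n` : the number of words of length `n` with entries in `S` whose total
sum is `0` and all of whose prefix sums are `≤ 0`. -/
def walkCount (S : Finset ℤ) (n : ℕ) : ℕ :=
  (Finset.univ.filter (fun w : Fin n → S =>
      (∑ i : Fin n, (w i : ℤ)) = 0 ∧
      ∀ j : ℕ, j ≤ n →
        (∑ i ∈ Finset.univ.filter (fun i : Fin n => (i : ℕ) < j), (w i : ℤ)) ≤ 0)).card

/-- In characteristic zero, an element of a field extension whose differential vanishes is
algebraic over the base field. -/
theorem isAlgebraic_of_kaehlerD_eq_zero {K L : Type*} [Field K] [Field L] [CharZero K]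
    [Algebra K L] {f : L} (hf : KaehlerDifferential.D K L f = 0) : IsAlgebraic K f := by
  set E := IntermediateField.adjoin K {f}
  have : Algebra.EssFiniteType K E := by
    rw [IntermediateField.essFiniteType_iff]
    exact ⟨{f}, by simp [E]⟩
  obtain ⟨ι, v, hv⟩ := exists_isTranscendenceBasis' E L
  have halg := hv.isAlgebraic_field
  have : Algebra.FormallySmooth E L :=
    .of_algebraicIndependent_of_isSeparable hv.1
  have hinj : Function.Injective (KaehlerDifferential.mapBaseChange K E L) := by
    rw [injective_iff_map_eq_zero]
    intro x hx
    obtain ⟨x, rfl⟩ := (Algebra.H1Cotangent.exact_δ_mapBaseChange K E L x).mp hx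
    rw [Subsingleton.elim x 0, map_zero]
  have hg : KaehlerDifferential.D K E (IntermediateField.AdjoinSimple.gen K f) = 0 := by
    have : Module.Free E L := Module.Free.of_divisionRing E L
    have : Module.FaithfullyFlat E L := Module.FaithfullyFlat.instOfNontrivialOfFree E L
    refine (Module.FaithfullyFlat.one_tmul_eq_zero_iff (R := E) (M := Ω[E⁄K]) (A := L) _).mp
      (hinj ?_)
    simp [hf]
  have hD (x : L) (hx : x ∈ E) : KaehlerDifferential.D K E ⟨x, hx⟩ = 0 := by
    induction hx using IntermediateField.adjoin_induction with
    | mem x hx =>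
      obtain rfl : x = f := hx
      exact hg
    | algebraMap x => exact (KaehlerDifferential.D K E).map_algebraMap x
    | add x y hx hy h₁ h₂ =>
      have := (KaehlerDifferential.D K E).map_add ⟨x, hx⟩ ⟨y, hy⟩
      rwa [h₁, h₂, add_zero] at this
    | inv x hx h =>
      have := (KaehlerDifferential.D K E).leibniz_inv ⟨x, hx⟩
      rwa [h, smul_zero] at this
    | mul x y hx hy h₁ h₂ =>
      have := (KaehlerDifferential.D K E).leibniz ⟨x, hx⟩ ⟨y, hy⟩
      rwa [h₁, h₂, smul_zero, smul_zero, add_zero] at this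
  have : Algebra.FormallyUnramified K E := by
    rw [Algebra.formallyUnramified_iff, ← Submodule.subsingleton_iff E,
      ← subsingleton_iff_bot_eq_top, ← KaehlerDifferential.span_range_derivation, eq_comm,
      Submodule.span_eq_bot]
    rintro _ ⟨⟨x, hx⟩, rfl⟩
    exact hD x hx
  have := (Algebra.FormallyUnramified.iff_isSeparable K E).mp this
  exact IntermediateField.isAlgebraic_iff.mp
    (Algebra.IsAlgebraic.isAlgebraic (R := K) (IntermediateField.AdjoinSimple.gen K f))

/-- The values of a derivation on the subalgebra generated by `s` are combinations of its values
on `s`. -/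
theorem Derivation.apply_mem_span_of_mem_adjoin {A R M : Type*} [CommRing A] [CommRing R]
    [Algebra A R] [AddCommGroup M] [Module A M] [Module R M] (D : Derivation A R M)
    {s : Set R} {p : R} (hp : p ∈ Algebra.adjoin A s) : D p ∈ Submodule.span R (D '' s) := by
  induction hp using Algebra.adjoin_induction with
  | mem x hx => exact Submodule.subset_span ⟨x, hx, rfl⟩
  | algebraMap a => simp
  | add x y _ _ hx hy => simpa using add_mem hx hy
  | mul x y _ _ hx hy =>
    simpa using add_mem (Submodule.smul_mem _ x hy) (Submodule.smul_mem _ y hx)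

/-- If every element of a finite set `s` lies in `A + t A[s]` with `t` in the Jacobson radical,
then the elements of `s` are algebraic over `A`. -/
theorem isAlgebraic_of_mem_add_jacobson_mul_adjoin {A R : Type*} [CommRing A] [IsDomain A]
    [CharZero A] [CommRing R] [IsDomain R] [Algebra A R] [FaithfulSMul A R] {s : Set R}
    (hs : s.Finite) {t : A} (ht : algebraMap A R t ∈ (⊥ : Ideal R).jacobson)
    (h : ∀ x ∈ s, ∃ a : A, ∃ p ∈ Algebra.adjoin A s,
      x = algebraMap A R a + algebraMap A R t * p)
    {x : R} (hx : x ∈ s) : IsAlgebraic A x := by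
  let := FractionRing.liftAlgebra A (FractionRing R)
  have := FractionRing.isScalarTower_liftAlgebra A (FractionRing R)
  have : CharZero (FractionRing A) :=
    charZero_of_injective_algebraMap (IsFractionRing.injective A (FractionRing A))
  let D : Derivation A R (Ω[FractionRing R⁄FractionRing A]) :=
    ((KaehlerDifferential.D (FractionRing A) (FractionRing R)).restrictScalars A).compAlgebraMap R
  have hN : Submodule.span R (D '' s) = ⊥ := by
    refine Submodule.eq_bot_of_le_smul_of_le_jacobson_bot (Ideal.span {algebraMap A R t}) _
      (Submodule.fg_span (hs.image D)) (Submodule.span_le.mpr ?_)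
      ((Ideal.span_singleton_le_iff_mem _).mpr ht)
    rintro _ ⟨x, hx, rfl⟩
    obtain ⟨a, p, hp, rfl⟩ := h x hx
    have : D (algebraMap A R a + algebraMap A R t * p) = algebraMap A R t • D p := by
      simp
    rw [this]
    exact Submodule.smul_mem_smul (Ideal.mem_span_singleton_self _)
      (D.apply_mem_span_of_mem_adjoin hp)
  have hDx : D x = 0 := Submodule.span_eq_bot.mp hN _ ⟨x, hx, rfl⟩
  have := isAlgebraic_of_kaehlerD_eq_zero (K := FractionRing A) (L := FractionRing R)
    (f := algebraMap R (FractionRing R) x) hDx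
  rw [← IsFractionRing.isAlgebraic_iff A] at this
  exact (isAlgebraic_algebraMap_iff (IsFractionRing.injective R (FractionRing R))).mp this

open PowerSeries

/-- The number of walks of length `n` from `i` to `j ≥ 0` on the non-negative integers, with steps
`-s` for `s ∈ S`. -/
def halfLineWalkCount (S : Finset ℤ) (j : ℤ) : ℕ → ℤ → ℕ
  | 0, i => if i = j then 1 else 0
  | n + 1, i => if 0 ≤ i then ∑ s ∈ S, halfLineWalkCount S j n (i - s) else 0

theorem card_filter_eq_halfLineWalkCount (S : Finset ℤ) (n : ℕ) (i : ℤ) :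
    (Finset.univ.filter (fun w : Fin n → S =>
      (∑ l : Fin n, (w l : ℤ)) = i ∧ ∀ j : ℕ, j ≤ n →
        (∑ l ∈ Finset.univ.filter (fun l : Fin n => (l : ℕ) < j), (w l : ℤ)) ≤ i)).card =
      halfLineWalkCount S 0 n i := by
  induction n generalizing i with
  | zero =>
    rw [Finset.card_filter]
    simp only [halfLineWalkCount, Finset.univ_eq_empty, Finset.sum_empty, Finset.filter_empty]
    by_cases hi : i = 0 <;> simp [hi, eq_comm]
  | succ n ih =>
    have key (s : S) (w : Fin n → S) :
        ((∑ l, ((Fin.cons s w : Fin (n + 1) → S) l : ℤ)) = i ∧ ∀ j : ℕ, j ≤ n + 1 →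
          (∑ l ∈ Finset.univ.filter (fun l : Fin (n + 1) => (l : ℕ) < j),
            ((Fin.cons s w : Fin (n + 1) → S) l : ℤ)) ≤ i) ↔
        0 ≤ i ∧ (∑ l, (w l : ℤ)) = i - s ∧ ∀ j : ℕ, j ≤ n →
          (∑ l ∈ Finset.univ.filter (fun l : Fin n => (l : ℕ) < j), (w l : ℤ)) ≤ i - s := by
      have hcons (j : ℕ) : (∑ l ∈ Finset.univ.filter (fun l : Fin (n + 1) => (l : ℕ) < j + 1),
          ((Fin.cons s w : Fin (n + 1) → S) l : ℤ)) =
          s + ∑ l ∈ Finset.univ.filter (fun l : Fin n => (l : ℕ) < j), (w l : ℤ) := by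
        simp [Finset.sum_filter, Fin.sum_univ_succ]
      constructor
      · rintro ⟨h₁, h₂⟩
        refine ⟨by simpa using h₂ 0 (by omega), ?_, fun j hj => ?_⟩
        · rw [Fin.sum_univ_succ] at h₁
          simp only [Fin.cons_zero, Fin.cons_succ] at h₁
          omega
        · have := h₂ (j + 1) (by omega)
          rw [hcons] at this
          omega
      · rintro ⟨h₀, h₁, h₂⟩
        refine ⟨?_, fun j hj => ?_⟩
        · rw [Fin.sum_univ_succ]
          simp only [Fin.cons_zero, Fin.cons_succ]
          omega
        · cases j with
          | zero => simpa using h₀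
          | succ j =>
            rw [hcons]
            have := h₂ j (by omega)
            omega
    rw [Finset.card_filter, ← (Fin.consEquiv fun _ => S).sum_comp, Fintype.sum_prod_type]
    simp only [Fin.consEquiv_apply, key, halfLineWalkCount]
    split_ifs with hi
    · simp only [hi, true_and, ← Finset.card_filter, ih]
      exact Finset.sum_coe_sort S fun s => halfLineWalkCount S 0 n (i - s)
    · simp [hi]

/-- The generating function of `halfLineWalkCount` by length. -/
noncomputable def halfLineWalkSeries (S : Finset ℤ) (j i : ℤ) : ℚ⟦X⟧ :=
  PowerSeries.mk fun n => (halfLineWalkCount S j n i : ℚ)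

theorem halfLineWalkSeries_of_neg (S : Finset ℤ) {j i : ℤ} (hj : 0 ≤ j) (hi : i < 0) :
    halfLineWalkSeries S j i = 0 := by
  ext n
  cases n with
  | zero => simp [halfLineWalkSeries, halfLineWalkCount, (hi.trans_le hj).ne]
  | succ n => simp [halfLineWalkSeries, halfLineWalkCount, hi.not_ge]

theorem halfLineWalkSeries_of_nonneg (S : Finset ℤ) (j : ℤ) {i : ℤ} (hi : 0 ≤ i) :
    halfLineWalkSeries S j i =
      (if i = j then 1 else 0) + X * ∑ s ∈ S, halfLineWalkSeries S j (i - s) := by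
  ext n
  cases n with
  | zero => split_ifs with h <;> simp [halfLineWalkSeries, halfLineWalkCount, h]
  | succ n =>
    split_ifs with h <;>
      simp [halfLineWalkSeries, halfLineWalkCount, hi, PowerSeries.coeff_succ_X_mul,
        PowerSeries.coeff_one]

/-- The homogeneous first-step recursion on the half-line has only the trivial solution. -/
theorem eq_zero_of_firstStep (S : Finset ℤ) (u : ℤ → ℚ⟦X⟧) (hneg : ∀ i < 0, u i = 0)
    (hrec : ∀ i, 0 ≤ i → u i = X * ∑ s ∈ S, u (i - s)) (i : ℤ) : u i = 0 := by
  ext n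
  rw [map_zero]
  induction n generalizing i with
  | zero =>
    rcases lt_or_ge i 0 with hi | hi
    · simp [hneg i hi]
    · simp [hrec i hi]
  | succ n ih =>
    rcases lt_or_ge i 0 with hi | hi
    · simp [hneg i hi]
    · simp [hrec i hi, PowerSeries.coeff_succ_X_mul, ih]

/-- Decomposition of a walk from `i + k` to `j < k` at its first step below level `k`. -/
theorem halfLineWalkSeries_add (S : Finset ℤ) {k : ℤ} (hS : ∀ s ∈ S, s ≤ k) {i j : ℤ}
    (hi : 0 ≤ i) (hj : 0 ≤ j) (hjk : j < k) :
    halfLineWalkSeries S j (i + k) = X * ∑ l ∈ Finset.Ico 0 k, halfLineWalkSeries S l i *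
      ∑ s ∈ S with l < s, halfLineWalkSeries S j (l + k - s) := by
  set B : ℤ → ℚ⟦X⟧ := fun l => ∑ s ∈ S with l < s, halfLineWalkSeries S j (l + k - s) with hB
  let u : ℤ → ℚ⟦X⟧ := fun i => (if 0 ≤ i then halfLineWalkSeries S j (i + k) else 0) -
    X * ∑ l ∈ Finset.Ico 0 k, halfLineWalkSeries S l i * B l
  have hu : u i = 0 := by
    refine eq_zero_of_firstStep S u (fun i hi => ?_) (fun i hi => ?_) i
    · simp only [u, if_neg hi.not_ge, zero_sub, neg_eq_zero]
      rw [Finset.sum_eq_zero, mul_zero]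
      intro l hl
      rw [halfLineWalkSeries_of_neg S (Finset.mem_Ico.mp hl).1 hi, zero_mul]
    · have h₁ : halfLineWalkSeries S j (i + k) =
          X * (∑ s ∈ S, (if 0 ≤ i - s then halfLineWalkSeries S j (i - s + k) else 0) + B i) := by
        rw [halfLineWalkSeries_of_nonneg S j (by omega), if_neg (by omega), zero_add, hB]
        simp only [Finset.sum_filter]
        rw [← Finset.sum_add_distrib]
        congr 1
        refine Finset.sum_congr rfl fun s _ => ?_
        have : i + k - s = i - s + k := by ring
        rw [this]
        by_cases h : i < s
        · rw [if_neg (by omega), if_pos h, zero_add]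
        · rw [if_pos (by omega), if_neg h, add_zero]
      have h₂ : ∑ l ∈ Finset.Ico 0 k, halfLineWalkSeries S l i * B l =
          B i + X * ∑ s ∈ S, ∑ l ∈ Finset.Ico 0 k, halfLineWalkSeries S l (i - s) * B l := by
        have hBi : ∑ l ∈ Finset.Ico 0 k, (if i = l then 1 else 0) * B l = B i := by
          simp only [ite_mul, one_mul, zero_mul, Finset.sum_ite_eq, Finset.mem_Ico]
          split_ifs with h
          · rfl
          · rw [hB]
            simp only
            rw [Finset.filter_false_of_mem, Finset.sum_empty]
            intro s hs
            have := hS s hs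
            omega
        rw [Finset.sum_comm, Finset.mul_sum, ← hBi, ← Finset.sum_add_distrib]
        refine Finset.sum_congr rfl fun l _ => ?_
        rw [halfLineWalkSeries_of_nonneg S l hi, add_mul, ← Finset.sum_mul, mul_assoc]
      simp only [u, if_pos hi]
      rw [h₁, h₂, Finset.sum_sub_distrib, ← Finset.mul_sum]
      ring
  simpa [u, hi, sub_eq_zero] using hu

theorem isAlgebraic_halfLineWalkSeries (S : Finset ℤ) {i j : ℤ} (hi : 0 ≤ i) (hj : 0 ≤ j) :
    IsAlgebraic (Polynomial ℚ) (halfLineWalkSeries S j i) := by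
  obtain ⟨k, hik, hjk, hS⟩ : ∃ k : ℤ, i < k ∧ j < k ∧ ∀ s ∈ S, |s| ≤ k := by
    refine ⟨i + j + 1 + ∑ s ∈ S, |s|, ?_, ?_, fun s hs => ?_⟩
    all_goals have := Finset.sum_nonneg fun s (_ : s ∈ S) => abs_nonneg s
    · omega
    · omega
    · have := Finset.single_le_sum (fun s (_ : s ∈ S) => abs_nonneg s) hs
      omega
  let T : Set ℚ⟦X⟧ := Set.image2 (halfLineWalkSeries S) (Set.Ico 0 k) (Set.Ico 0 k)
  have hX : algebraMap (Polynomial ℚ) ℚ⟦X⟧ Polynomial.X = X := by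
    simp [PowerSeries.algebraMap_apply']
  have hXmem : (X : ℚ⟦X⟧) ∈ Algebra.adjoin (Polynomial ℚ) T := by
    rw [← hX]
    exact Subalgebra.algebraMap_mem _ _
  have : FaithfulSMul (Polynomial ℚ) ℚ⟦X⟧ := by
    rw [faithfulSMul_iff_algebraMap_injective]
    exact Polynomial.coe_injective ℚ
  have hmem {a b : ℤ} (ha : 0 ≤ a) (hak : a < k) (hb : b < k) :
      halfLineWalkSeries S a b ∈ Algebra.adjoin (Polynomial ℚ) T := by
    rcases lt_or_ge b 0 with hb₀ | hb₀
    · rw [halfLineWalkSeries_of_neg S ha hb₀]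
      exact zero_mem _
    · exact Algebra.subset_adjoin ⟨a, ⟨ha, hak⟩, b, ⟨hb₀, hb⟩, rfl⟩
  refine isAlgebraic_of_mem_add_jacobson_mul_adjoin (s := T) (t := Polynomial.X)
    ((Set.finite_Ico _ _).image2 _ (Set.finite_Ico _ _)) ?_ ?_ ⟨j, ⟨hj, hjk⟩, i, ⟨hi, hik⟩, rfl⟩
  · rw [IsLocalRing.jacobson_eq_maximalIdeal _ bot_ne_top, hX, IsLocalRing.mem_maximalIdeal,
      mem_nonunits_iff, PowerSeries.isUnit_iff_constantCoeff]
    simp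
  · rintro _ ⟨b, ⟨hb, hbk⟩, a, ⟨ha, hak⟩, rfl⟩
    refine ⟨if a = b then 1 else 0, ∑ s ∈ S, halfLineWalkSeries S b (a - s), ?_, ?_⟩
    · refine sum_mem fun s hs => ?_
      rcases lt_or_ge (a - s) k with h | h
      · exact hmem hb hbk h
      · have hs' := abs_le.mp (hS s hs)
        rw [← sub_add_cancel (a - s) k, halfLineWalkSeries_add S
          (fun s hs => (abs_le.mp (hS s hs)).2) (by omega) hb hbk]
        refine mul_mem hXmem (sum_mem fun l hl => ?_)
        rw [Finset.mem_Ico] at hl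
        refine mul_mem (hmem hl.1 hl.2 (by omega)) (sum_mem fun r hr => ?_)
        rw [Finset.mem_filter] at hr
        exact hmem hb hbk (by omega)
    · rw [hX, halfLineWalkSeries_of_nonneg S b ha]
      split_ifs <;> simp

/-- For any finite set `S` of integers, the ordinary generating function
`f(t) = Σ_n a_S(n) tⁿ` of the numbers of zero-sum words over `S` with non-positive
prefix sums is algebraic over `ℚ[t]`. -/
theorem walk_generating_function_is_algebraic (S : Finset ℤ) :
    ∃ (d : ℕ), 1 ≤ d ∧ ∃ c : Fin (d + 1) → Polynomial ℚ,
      (∃ i, c i ≠ 0) ∧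
      ∑ i : Fin (d + 1), ((c i : PowerSeries ℚ) *
        (PowerSeries.mk fun n => (walkCount S n : ℚ)) ^ (i : ℕ)) = 0 := by
  have hf : (PowerSeries.mk fun n => (walkCount S n : ℚ)) = halfLineWalkSeries S 0 0 := by
    ext n
    simp only [halfLineWalkSeries, PowerSeries.coeff_mk, walkCount,
      ← card_filter_eq_halfLineWalkCount]
  rw [hf]
  obtain ⟨p, hp, hpf⟩ := isAlgebraic_halfLineWalkSeries S le_rfl le_rfl
  refine ⟨p.natDegree + 1, by omega, fun i => p.coeff i, ?_, ?_⟩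
  · exact ⟨⟨p.natDegree, by omega⟩, by simpa using hp⟩
  · rw [Fin.sum_univ_eq_sum_range
      (fun i => ((p.coeff i : Polynomial ℚ) : ℚ⟦X⟧) * halfLineWalkSeries S 0 0 ^ i)]
    rw [Polynomial.aeval_eq_sum_range' (n := p.natDegree + 1 + 1) (by omega)] at hpf
    rw [← hpf]
    refine Finset.sum_congr rfl fun i _ => ?_
    rw [Algebra.smul_def]
    rfl
end

section
/- Let S be a finite set of integers and, for n ≥ 0, let a_S(n) be the number of words w = (w_1, …, w_n) with all entries in S whose total sum equals 0 and all of whose prefix sums w_1 + ⋯ + w_j (1 ≤ j ≤ n) are ≤ 0. Then the sequence a_S(n) is P-recursive: there exist a positive integer L and polynomials p_0(x), …, p_L(x) with rational coefficients, not all zero, such that p_0(n)·a_S(n) + p_1(n)·a_S(n−1) + ⋯ + p_L(n)·a_S(n−L) = 0 for all n ≥ L. -/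
section Derivation

open Polynomial

/-- An additive map satisfying the Leibniz rule is a derivation. -/
def Derivation.ofAddMonoidHom {L : Type*} [CommRing L] (D : L →+ L)
    (h : ∀ x y, D (x * y) = x * D y + y * D x) : Derivation ℤ L L :=
  Derivation.mk' D.toIntLinearMap h

theorem Derivation.apply_aeval_sub_mem {k L : Type*} [Field k] [Field L]
    [Algebra k L] (D : Derivation ℤ L L) (M : IntermediateField k L)
    (hD : ∀ a : k, D (algebraMap k L a) ∈ M) {x : L} (hx : x ∈ M) (f : k[X]) :
    D (aeval x f) - aeval x (derivative f) * D x ∈ M := by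
  induction f using Polynomial.induction_on' with
  | add p q hp hq =>
    convert add_mem hp hq using 1
    simp only [map_add]
    ring
  | monomial n a =>
    convert mul_mem (pow_mem hx n) (hD a) using 1
    simp only [aeval_monomial, Derivation.leibniz, Derivation.leibniz_pow, derivative_monomial,
      smul_eq_mul, nsmul_eq_mul, map_mul, _root_.map_natCast]
    ring

/-- A derivation maps a separable intermediate field into itself as soon as it maps the base field
into it. -/
theorem Derivation.mem_of_isSeparable {k L : Type*} [Field k] [Field L]
    [Algebra k L] (D : Derivation ℤ L L) (M : IntermediateField k L)
    (hD : ∀ a : k, D (algebraMap k L a) ∈ M) {x : L} (hx : x ∈ M) (hs : IsSeparable k x) :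
    D x ∈ M := by
  have h := D.apply_aeval_sub_mem M hD hx (minpoly k x)
  rw [minpoly.aeval, map_zero, zero_sub, neg_mem_iff] at h
  have h0 : aeval x (derivative (minpoly k x)) ≠ 0 :=
    hs.aeval_derivative_ne_zero (minpoly.aeval k x)
  have hM : aeval x (derivative (minpoly k x)) ∈ M := by
    rw [aeval_eq_sum_range]
    exact sum_mem fun i _ => M.smul_mem (pow_mem hx i)
  simpa [h0] using mul_mem (inv_mem hM) h

theorem Derivation.map_div_mem {k L : Type*} [Field k] [Field L] [Algebra k L]
    (D : Derivation ℤ L L) (M : IntermediateField k L) {x y : L} (hx : x ∈ M) (hy : y ∈ M)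
    (hDx : D x ∈ M) (hDy : D y ∈ M) : D (x / y) ∈ M := by
  rw [Derivation.leibniz_div]
  exact mul_mem (pow_mem (inv_mem hy) 2) (sub_mem (mul_mem hy hDx) (mul_mem hx hDy))

/-- The iterated derivatives of a separable algebraic element are linearly dependent. -/
theorem Derivation.exists_sum_smul_iterate_eq_zero {A k L : Type*} [CommRing A]
    [IsDomain A] [Field k] [Field L] [CharZero k] [Algebra A k] [IsFractionRing A k]
    [Algebra A L] [Algebra k L] [IsScalarTower A k L] (D : Derivation ℤ L L)
    (hD : ∀ a : k, D (algebraMap k L a) ∈ (⊥ : IntermediateField k L)) {x : L}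
    (hx : IsAlgebraic k x) :
    ∃ d : ℕ, ∃ q : Fin d → A, (∃ i, q i ≠ 0) ∧ ∑ i, q i • D^[i] x = 0 := by
  set M := IntermediateField.adjoin k {x}
  have : FiniteDimensional k M := IntermediateField.adjoin.finiteDimensional hx.isIntegral
  have hmem (i : ℕ) : D^[i] x ∈ M := by
    induction i with
    | zero => exact IntermediateField.mem_adjoin_simple_self _ x
    | succ i ih =>
      rw [Function.iterate_succ_apply']
      refine D.mem_of_isSeparable M (fun a => bot_le (a := M) (hD a)) ih ?_
      exact (minpoly.irreducible ((IsIntegral.of_finite k (⟨_, ih⟩ : M)).map M.val)).separable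
  refine ⟨Module.finrank k M + 1, ?_⟩
  have hdep : ¬ LinearIndependent k
      (fun i : Fin (Module.finrank k M + 1) => (⟨_, hmem i⟩ : M)) := fun h => by
    simpa using h.fintype_card_le_finrank
  have hdep' : ¬ LinearIndependent A
      (fun i : Fin (Module.finrank k M + 1) => D^[i] x) := fun h => by
    rw [LinearIndependent.iff_fractionRing A k] at h
    exact hdep (LinearIndependent.of_comp M.val.toLinearMap h)
  obtain ⟨q, hq, hne⟩ := Fintype.not_linearIndependent_iff.mp hdep'
  exact ⟨q, hne, hq⟩

/-- A factor of a polynomial over `k` has algebraic coefficients if its leading coefficient is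
algebraic. -/
theorem isAlgebraic_coeff_of_dvd {k L : Type*} [Field k] [Field L] [Algebra k L]
    {p : k[X]} {q : L[X]} (hp : p ≠ 0) (hdvd : q ∣ p.map (algebraMap k L))
    (hlc : IsAlgebraic k q.leadingCoeff) (i : ℕ) : IsAlgebraic k (q.coeff i) := by
  have hq : q ≠ 0 := by
    rintro rfl
    exact hp (by simpa using hdvd)
  have h := isIntegral_coeff_of_dvd (p * C p.leadingCoeff⁻¹) (q * C q.leadingCoeff⁻¹)
    (monic_mul_leadingCoeff_inv hp) (monic_mul_leadingCoeff_inv hq) (by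
      rw [Polynomial.map_mul]
      refine (IsUnit.dvd_mul_right ?_).mpr ((IsUnit.mul_right_dvd ?_).mpr hdvd)
      · simpa using hp
      · simpa using hq) i
  have := h.isAlgebraic.mul hlc
  rwa [coeff_mul_C, inv_mul_cancel_right₀ (by simpa using hq)] at this

end Derivation

section Euler

open scoped LaurentSeries RatFunc

variable {F : Type*} [Field F]

/-- The coefficientwise map `∑ aₙ tⁿ ↦ ∑ n aₙ tⁿ` on Laurent series. -/
noncomputable def LaurentSeries.eulerHom : F⸨X⸩ →+ F⸨X⸩ where
  toFun f :=
    { coeff := fun n => n * f.coeff n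
      isPWO_support' := f.isPWO_support.mono fun n hn h => hn (by simp [h]) }
  map_zero' := by
    ext n
    simp
  map_add' f g := by
    ext n
    simp [mul_add]

theorem LaurentSeries.eulerHom_coeff (f : F⸨X⸩) (n : ℤ) :
    (eulerHom f).coeff n = n * f.coeff n :=
  rfl

/-- The Euler derivation `t * d/dt` on Laurent series. -/
noncomputable def LaurentSeries.euler :=
  Derivation.ofAddMonoidHom (eulerHom (F := F)) fun f g => by
    ext n
    have h1 : (f * eulerHom g).coeff n = _ := HahnSeries.coeff_mul_right' g.isPWO_support
      (fun n hn h => hn (by simp [eulerHom_coeff, h]))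
    have h2 : (eulerHom f * g).coeff n = _ := HahnSeries.coeff_mul_left' f.isPWO_support
      (fun n hn h => hn (by simp [eulerHom_coeff, h]))
    rw [eulerHom_coeff, mul_comm g, HahnSeries.coeff_add, h1, h2, HahnSeries.coeff_mul,
      Finset.mul_sum, ← Finset.sum_add_distrib]
    refine Finset.sum_congr rfl fun ij hij => ?_
    rw [← (Finset.mem_antidiagonal.mp hij).2.2, eulerHom_coeff, eulerHom_coeff]
    push_cast
    ring

theorem LaurentSeries.euler_coeff (f : F⸨X⸩) (n : ℤ) : (euler f).coeff n = n * f.coeff n := rfl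

theorem LaurentSeries.euler_coe (f : PowerSeries F) :
    euler (f : F⸨X⸩) = (PowerSeries.mk fun n => (n : F) * f.coeff n : PowerSeries F) := by
  ext n
  rw [euler_coeff, PowerSeries.coeff_coe, PowerSeries.coeff_coe]
  split_ifs with h
  · simp
  · lift n to ℕ using by omega
    simp

theorem LaurentSeries.euler_iterate_coe (f : PowerSeries F) (i : ℕ) :
    euler^[i] (f : F⸨X⸩) = (PowerSeries.mk fun n => (n : F) ^ i * f.coeff n : PowerSeries F) := by
  induction i with
  | zero => simp; congr; ext; simp
  | succ i ih =>
    rw [Function.iterate_succ_apply', ih, euler_coe]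
    congr 1
    ext n
    simp
    ring

theorem LaurentSeries.euler_algebraMap_mem (a : RatFunc F) :
    euler (algebraMap (RatFunc F) F⸨X⸩ a) ∈ (⊥ : IntermediateField (RatFunc F) F⸨X⸩) := by
  set M : IntermediateField (RatFunc F) F⸨X⸩ := ⊥
  have hpoly (p : Polynomial F) : algebraMap (Polynomial F) F⸨X⸩ p ∈ M := by
    rw [IsScalarTower.algebraMap_apply (Polynomial F) (RatFunc F) F⸨X⸩]
    exact M.algebraMap_mem _
  have heuler (p : Polynomial F) : euler (algebraMap (Polynomial F) F⸨X⸩ p) ∈ M := by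
    convert hpoly (Polynomial.X * Polynomial.derivative p) using 1
    have h (q : Polynomial F) : algebraMap (Polynomial F) F⸨X⸩ q = ((q : PowerSeries F) : F⸨X⸩) :=
      rfl
    rw [h, h, euler_coe]
    congr 1
    ext n
    cases n with
    | zero => simp
    | succ n => simp [Polynomial.coeff_derivative, mul_comm]
  obtain ⟨p, q, -, rfl⟩ := IsFractionRing.div_surjective (A := Polynomial F) a
  rw [map_div₀, ← IsScalarTower.algebraMap_apply, ← IsScalarTower.algebraMap_apply]
  exact euler.map_div_mem M (hpoly p) (hpoly q) (heuler p) (heuler q)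

open Polynomial in
/-- The coefficients of an algebraic power series form a P-recursive sequence. -/
theorem exists_recurrence_of_isAlgebraic [CharZero F] (a : ℕ → F)
    (ha : IsAlgebraic (RatFunc F) ((PowerSeries.mk a : PowerSeries F) : F⸨X⸩)) :
    ∃ (L : ℕ), 0 < L ∧ ∃ p : Fin (L + 1) → F[X], (∃ i, p i ≠ 0) ∧
      ∀ n : ℕ, L ≤ n → ∑ i : Fin (L + 1), (p i).eval (n : F) * a (n - i) = 0 := by
  obtain ⟨d, q, ⟨i₀, hi₀⟩, hq⟩ := LaurentSeries.euler.exists_sum_smul_iterate_eq_zero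
    (A := F[X]) LaurentSeries.euler_algebraMap_mem ha
  set L := Finset.univ.sup (fun i => (q i).natDegree) + 1
  have hdeg (i) : (q i).natDegree < L :=
    Nat.lt_succ_of_le (Finset.le_sup (f := fun i => (q i).natDegree) (Finset.mem_univ i))
  set p : ℕ → F[X] := fun j => (∑ i, C ((q i).coeff j) * X ^ (i : ℕ)).comp (X - C (j : F)) with hp
  refine ⟨L, Nat.succ_pos _, fun j => p j,
    ⟨⟨(q i₀).natDegree, (hdeg i₀).trans (Nat.lt_succ_self L)⟩, ?_⟩, ?_⟩
  · intro h
    have h' := congrArg (fun r => (r.comp (X + C ((q i₀).natDegree : F))).coeff i₀) h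
    simp only [hp, comp_assoc, sub_comp, X_comp, C_comp, add_sub_cancel_right, comp_X, zero_comp,
      finsetSum_coeff, coeff_C_mul, coeff_X_pow, coeff_zero] at h'
    simp [Fin.val_inj, hi₀] at h'
  · intro n hn
    have hps : ∑ i, (q i : PowerSeries F) *
        PowerSeries.mk (fun n => (n : F) ^ (i : ℕ) * a n) = 0 := by
      apply HahnSeries.ofPowerSeries_injective (Γ := ℤ)
      rw [map_zero, map_sum, ← hq]
      refine Finset.sum_congr rfl fun i _ => ?_
      rw [LaurentSeries.euler_iterate_coe, map_mul, Algebra.smul_def]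
      simp only [PowerSeries.coeff_mk]
      rfl
    have hc := congrArg (PowerSeries.coeff n) hps
    rw [map_sum, map_zero] at hc
    rw [← hc]
    simp only [PowerSeries.coeff_mul, Finset.Nat.sum_antidiagonal_eq_sum_range_succ_mk,
      Polynomial.coeff_coe, PowerSeries.coeff_mk]
    rw [Finset.sum_comm]
    rw [Fin.sum_univ_eq_sum_range (fun j => (p j).eval (n : F) * a (n - j)) (L + 1)]
    refine Finset.sum_subset_zero_on_sdiff (by simpa using hn) ?_ ?_
    · intro j hj
      refine Finset.sum_eq_zero fun i _ => ?_
      have := hdeg i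
      rw [Polynomial.coeff_eq_zero_of_natDegree_lt, zero_mul]
      simp at hj
      omega
    · intro j hj
      simp at hj
      simp only [hp, eval_comp, eval_finsetSum, eval_mul, eval_pow, eval_sub, eval_X, eval_C,
        Finset.sum_mul]
      refine Finset.sum_congr rfl fun i _ => ?_
      rw [Nat.cast_sub (by omega), mul_assoc]

end Euler

/-- The number of words of length `n` over `S` with sum `z` and non-positive prefix sums. -/
def walkCountTo (S : Finset ℤ) (n : ℕ) (z : ℤ) : ℕ :=
  (Finset.univ.filter (fun w : Fin n → S =>
      (∑ i : Fin n, (w i : ℤ)) = z ∧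
      ∀ j : ℕ, j ≤ n →
        (∑ i ∈ Finset.univ.filter (fun i : Fin n => (i : ℕ) < j), (w i : ℤ)) ≤ 0)).card

theorem walkCountTo_zero_left (S : Finset ℤ) (z : ℤ) :
    walkCountTo S 0 z = if z = 0 then 1 else 0 := by
  by_cases h : z = 0 <;> simp [walkCountTo, h, eq_comm]

theorem walkCountTo_eq_zero_of_pos (S : Finset ℤ) (n : ℕ) {z : ℤ} (hz : 0 < z) :
    walkCountTo S n z = 0 := by
  rw [walkCountTo, Finset.card_eq_zero, Finset.filter_eq_empty_iff]
  rintro w - ⟨hw, h⟩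
  have := h n le_rfl
  rw [Finset.filter_true_of_mem (fun i _ => i.2), hw] at this
  omega

theorem walkCountTo_succ (S : Finset ℤ) (n : ℕ) {z : ℤ} (hz : z ≤ 0) :
    walkCountTo S (n + 1) z = ∑ s ∈ S, walkCountTo S n (z - s) := by
  simp only [walkCountTo, Finset.card_filter]
  rw [← (Fin.snocEquiv (fun _ : Fin (n + 1) => S)).sum_comp, Fintype.sum_prod_type,
    ← Finset.sum_coe_sort S]
  refine Finset.sum_congr rfl fun s _ => Finset.sum_congr rfl fun w _ => if_congr ?_ rfl rfl
  have hsum : ∑ i, ((Fin.snocEquiv (fun _ : Fin (n + 1) => S) (s, w) i : S) : ℤ) =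
      (∑ i, (w i : ℤ)) + s := by
    simp [Fin.sum_univ_castSucc, Fin.snocEquiv]
  have hpre : ∀ j ≤ n, (∑ i ∈ Finset.univ.filter (fun i : Fin (n + 1) => (i : ℕ) < j),
      ((Fin.snocEquiv (fun _ : Fin (n + 1) => S) (s, w) i : S) : ℤ)) =
        ∑ i ∈ Finset.univ.filter (fun i : Fin n => (i : ℕ) < j), (w i : ℤ) := by
    intro j hj
    simp [Finset.sum_filter, Fin.sum_univ_castSucc, Fin.snocEquiv, hj]
  rw [hsum]
  constructor
  · rintro ⟨h, hp⟩
    exact ⟨by omega, fun j hj => (hpre j hj).symm.trans_le (hp j (by omega))⟩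
  · rintro ⟨h, hp⟩
    refine ⟨by omega, fun j hj => ?_⟩
    rcases hj.lt_or_eq with hj | rfl
    · exact (hpre j (by omega)).trans_le (hp j (by omega))
    · rw [Finset.filter_true_of_mem (fun i _ => i.2), hsum]
      omega

/-- The series counting words over `S` with non-positive prefix sums, by length and by minus the
endpoint. -/
noncomputable def walkSeries (S : Finset ℤ) : PowerSeries (PowerSeries ℚ) :=
  .mk fun j => .mk fun n => (walkCountTo S n (-j) : ℚ)

open Polynomial in
/-- The kernel polynomial `v ^ b * (1 - t * ∑ s ∈ S, v ^ (-s))`. -/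
noncomputable def walkKernel (S : Finset ℤ) (b : ℕ) : ℚ[X][X] :=
  X ^ b - ∑ s ∈ S, C X * X ^ ((b : ℤ) - s).toNat

theorem coeff_walkSeries (S : Finset ℤ) (j : ℕ) :
    (walkSeries S).coeff j =
      (if j = 0 then 1 else 0) + PowerSeries.X * ∑ s ∈ S,
        if 0 ≤ (j : ℤ) + s then (walkSeries S).coeff ((j : ℤ) + s).toNat else 0 := by
  ext n
  cases n with
  | zero =>
    by_cases hj : j = 0 <;> simp [walkSeries, walkCountTo_zero_left, hj]
  | succ n =>
    have h1 : PowerSeries.coeff (n + 1) (if j = 0 then (1 : PowerSeries ℚ) else 0) = 0 := by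
      split_ifs <;> simp [PowerSeries.coeff_one]
    rw [map_add, h1, zero_add, PowerSeries.coeff_succ_X_mul, map_sum]
    simp only [walkSeries, PowerSeries.coeff_mk]
    rw [walkCountTo_succ S n (by omega), Nat.cast_sum]
    refine Finset.sum_congr rfl fun s _ => ?_
    split_ifs with h
    · rw [PowerSeries.coeff_mk, Int.toNat_of_nonneg h, neg_add']
    · rw [walkCountTo_eq_zero_of_pos S n (by omega)]
      simp

/-- The kernel polynomial with power series coefficients. -/
noncomputable def walkKernelSeries (S : Finset ℤ) (b : ℕ) : Polynomial (PowerSeries ℚ) :=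
  (walkKernel S b).map Polynomial.coeToPowerSeries.ringHom

theorem coeff_walkKernelSeries_mul (S : Finset ℤ) (b : ℕ) (hb : ∀ s ∈ S, s ≤ b) (m : ℕ) :
    ((walkKernelSeries S b : PowerSeries (PowerSeries ℚ)) * walkSeries S).coeff m =
      (if b ≤ m then (walkSeries S).coeff (m - b) else 0) - PowerSeries.X * ∑ s ∈ S,
        if (b : ℤ) ≤ m + s then (walkSeries S).coeff ((m : ℤ) - b + s).toNat else 0 := by
  have h : (walkKernelSeries S b : PowerSeries (PowerSeries ℚ)) =
      PowerSeries.X ^ b - ∑ s ∈ S, PowerSeries.C PowerSeries.X *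
        PowerSeries.X ^ ((b : ℤ) - s).toNat := by
    rw [← Polynomial.coeToPowerSeries.ringHom_apply, walkKernelSeries, walkKernel]
    rw [Polynomial.map_sub, Polynomial.map_sum, map_sub, map_sum]
    simp
  rw [h, sub_mul, Finset.sum_mul, map_sub, map_sum, PowerSeries.coeff_X_pow_mul', Finset.mul_sum]
  congr 1
  refine Finset.sum_congr rfl fun s hs => ?_
  have := hb s hs
  rw [mul_assoc, PowerSeries.coeff_C_mul, PowerSeries.coeff_X_pow_mul']
  congr 1
  refine if_congr (by omega) ?_ rfl
  congr 2
  omega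

/-- The kernel equation: the coefficients of `walkKernelSeries S b * walkSeries S` from `b` on are
`1, 0, 0, …`. -/
theorem coeff_walkKernelSeries_mul_add (S : Finset ℤ) (b : ℕ) (hb : ∀ s ∈ S, s ≤ b) (j : ℕ) :
    ((walkKernelSeries S b : PowerSeries (PowerSeries ℚ)) * walkSeries S).coeff (b + j) =
      if j = 0 then 1 else 0 := by
  rw [coeff_walkKernelSeries_mul S b hb, if_pos (Nat.le_add_right b j), Nat.add_sub_cancel_left,
    coeff_walkSeries S j, add_sub_assoc, add_eq_left, sub_eq_zero]
  congr 1
  refine Finset.sum_congr rfl fun s _ => if_congr (by omega) ?_ rfl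
  congr 2
  omega

theorem exists_isDistinguishedAt_walkKernelSeries (S : Finset ℤ) (b : ℕ) (hb : ∀ s ∈ S, s ≤ b) :
    ∃ g : Polynomial (PowerSeries ℚ),
      g.IsDistinguishedAt (IsLocalRing.maximalIdeal (PowerSeries ℚ)) ∧
        (g : PowerSeries (PowerSeries ℚ)) = walkKernelSeries S b * walkSeries S := by
  set h := (walkKernelSeries S b : PowerSeries (PowerSeries ℚ)) * walkSeries S with hh
  have hcoeff (m : ℕ) : (h.trunc (b + 1)).coeff m = h.coeff m := by
    rw [PowerSeries.coeff_trunc]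
    split_ifs with hm
    · rfl
    · obtain ⟨j, rfl⟩ := Nat.exists_eq_add_of_le (show b ≤ m by omega)
      rw [hh, coeff_walkKernelSeries_mul_add S b hb, if_neg (by omega)]
  have hlead : (h.trunc (b + 1)).coeff b = 1 := by
    rw [hcoeff]
    simpa using coeff_walkKernelSeries_mul_add S b hb 0
  have hdeg : (h.trunc (b + 1)).natDegree = b :=
    le_antisymm (Nat.lt_succ_iff.mp (PowerSeries.natDegree_trunc_lt _ _))
      (Polynomial.le_natDegree_of_ne_zero (by simp [hlead]))
  refine ⟨h.trunc (b + 1), ⟨⟨fun {m} hm => ?_⟩, ?_⟩, ?_⟩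
  · rw [hcoeff, hh, coeff_walkKernelSeries_mul S b hb, if_neg (by omega), zero_sub, neg_mem_iff]
    exact Ideal.mul_mem_right _ _ (by simp [PowerSeries.isUnit_iff_constantCoeff])
  · rw [Polynomial.Monic, Polynomial.leadingCoeff, hdeg, hlead]
  · ext1 m
    rw [Polynomial.coeff_coe, hcoeff]

/-- A factorization of a polynomial into a distinguished polynomial and a power series takes place
in the polynomial ring. -/
theorem Polynomial.IsDistinguishedAt.exists_eq_mul {A : Type*} [CommRing A] {I : Ideal A}
    [IsHausdorff I A] (hI : I ≠ ⊤) {f g : Polynomial A} (hg : g.IsDistinguishedAt I)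
    {c : PowerSeries A} (h : (f : PowerSeries A) = g * c) :
    ∃ q : Polynomial A, (q : PowerSeries A) = c ∧ f = g * q := by
  have hn : (g.natDegree : ℕ∞) = _ := hg.coe_natDegree_eq_order_map g 1
    (by rwa [map_one, ← Ideal.ne_top_iff_one]) (by simp)
  have hlt {r : Polynomial A} (hr : r.degree < g.natDegree) :
      r.degree < ((g : PowerSeries A).map (Ideal.Quotient.mk I)).order.toNat := by
    rwa [← hn]
  have : Nontrivial A := not_subsingleton_iff_nontrivial.mp fun _ => hI (Subsingleton.elim _ _)
  obtain ⟨hq, hr⟩ := (hg.isWeierstrassDivisorAt hI).eq_of_mul_add_eq_mul_add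
    (q := (f /ₘ g : Polynomial A)) (q' := c) (r := f %ₘ g) (r' := 0)
    (hlt ((degree_modByMonic_lt f hg.monic).trans_le degree_le_natDegree))
    (hlt (by simp [bot_lt_iff_ne_bot]))
    (by
      rw [coe_zero, add_zero, ← h, ← coe_mul, ← coe_add, add_comm, modByMonic_add_div])
  refine ⟨f /ₘ g, hq, ?_⟩
  conv_lhs => rw [← modByMonic_add_div f g, hr, zero_add]

open scoped LaurentSeries RatFunc

/-- The generating function of walks returning to the origin is algebraic. -/
theorem isAlgebraic_walkSeries_coeff_zero (S : Finset ℤ) :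
    IsAlgebraic (RatFunc ℚ) (((walkSeries S).coeff 0 : PowerSeries ℚ) : ℚ⸨X⸩) := by
  obtain ⟨b, hb⟩ : ∃ b : ℕ, ∀ s ∈ S, s ≤ b :=
    ⟨S.sup Int.toNat, fun s hs => Int.toNat_le.mp (Finset.le_sup (f := Int.toNat) hs)⟩
  obtain ⟨g, hg, hgf⟩ := exists_isDistinguishedAt_walkKernelSeries S b hb
  have hW : IsUnit (walkSeries S) := by
    simp [PowerSeries.isUnit_iff_constantCoeff, walkSeries, walkCountTo_zero_left]
  obtain ⟨c, hc⟩ := hW.exists_right_inv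
  obtain ⟨q, rfl, hq⟩ := hg.exists_eq_mul (Ideal.IsPrime.ne_top') (f := walkKernelSeries S b)
    (c := c) (by rw [hgf, mul_assoc, hc, mul_one])
  have hmul : (walkSeries S).coeff 0 * q.coeff 0 = 1 := by
    have := congrArg PowerSeries.constantCoeff hc
    simpa using this
  have hq0 : q ≠ 0 := by
    rintro rfl
    simp at hmul
  have hf0 : walkKernel S b ≠ 0 := by
    intro h
    rw [walkKernelSeries, h, Polynomial.map_zero] at hq
    exact mul_ne_zero hg.monic.ne_zero hq0 hq.symm
  set φ : PowerSeries ℚ →+* ℚ⸨X⸩ := HahnSeries.ofPowerSeries ℤ ℚ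
  have hφ : Function.Injective φ := HahnSeries.ofPowerSeries_injective
  have hmap : ((walkKernel S b).map (algebraMap (Polynomial ℚ) (RatFunc ℚ))).map
      (algebraMap (RatFunc ℚ) ℚ⸨X⸩) = g.map φ * q.map φ := by
    rw [← Polynomial.map_mul, ← hq, walkKernelSeries, Polynomial.map_map, Polynomial.map_map,
      ← IsScalarTower.algebraMap_eq]
    rfl
  have hlc : (q.map φ).leadingCoeff = algebraMap (RatFunc ℚ) ℚ⸨X⸩
      ((walkKernel S b).map (algebraMap (Polynomial ℚ) (RatFunc ℚ))).leadingCoeff := by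
    rw [← Polynomial.leadingCoeff_map, hmap, Polynomial.leadingCoeff_mul,
      (hg.monic.map φ).leadingCoeff, one_mul]
  have halg := isAlgebraic_coeff_of_dvd
    ((Polynomial.map_ne_zero_iff (IsFractionRing.injective _ _)).mpr hf0)
    (hmap ▸ dvd_mul_left _ _) (hlc ▸ isAlgebraic_algebraMap _) 0
  rw [Polynomial.coeff_map] at halg
  have := halg.inv
  rwa [inv_eq_of_mul_eq_one_left (by rw [← map_mul, hmul, map_one])] at this

/-- For any finite set `S` of integers, the sequence `a_S(n)` counting
zero-sum words over `S` with non-positive prefix sums is P-recursive: it satisfies a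
linear recurrence with polynomial coefficients, not all zero. -/
theorem walk_count_is_P_recursive (S : Finset ℤ) :
    ∃ (L : ℕ), 0 < L ∧ ∃ p : Fin (L + 1) → Polynomial ℚ,
      (∃ i, p i ≠ 0) ∧
      ∀ n : ℕ, L ≤ n →
        ∑ i : Fin (L + 1), (p i).eval (n : ℚ) * (walkCount S (n - (i : ℕ)) : ℚ) = 0 := by
  refine exists_recurrence_of_isAlgebraic (fun n => (walkCount S n : ℚ)) ?_
  convert isAlgebraic_walkSeries_coeff_zero S using 2
  ext n
  simp [walkSeries, walkCount, walkCountTo]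
end

section
/- Let a die on nonzero integers be given with rational probabilities: a finite set S of nonzero integers with p_s ∈ ℚ, p_s > 0 for s ∈ S, Σ_{s∈S} p_s = 1, and positive drift Σ_{s∈S} s·p_s > 0. Let a(k) ∈ ℚ be the probability that the walk first reaches a strictly positive position at exactly round k. Then the probability generating function f(t) = Σ_{k≥0} a(k) t^k, as a formal power series over ℚ, is algebraic over ℚ[t]: there exist d ≥ 1 and polynomials c_0(t), …, c_d(t) ∈ ℚ[t], not all zero, with c_0(t) + c_1(t)·f(t) + ⋯ + c_d(t)·f(t)^d = 0 as formal power series. -/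
/-- `hitProb S p k` : the probability that a walk on ℤ starting at 0, with steps drawn
from `S` with probabilities `p`, first reaches a strictly positive position at exactly
round `k`: the sum over words `w ∈ S^k` with all proper prefix sums `≤ 0` and total
sum `≥ 1` of the products of the step probabilities. -/
def hitProb (S : Finset ℤ) (p : ℤ → ℚ) (k : ℕ) : ℚ :=
  ∑ w ∈ Finset.univ.filter (fun w : Fin k → S =>
      (∀ j : ℕ, j < k →
        (∑ i ∈ Finset.univ.filter (fun i : Fin k => (i : ℕ) < j), (w i : ℤ)) ≤ 0) ∧
      1 ≤ ∑ i : Fin k, (w i : ℤ)),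
    ∏ i : Fin k, p (w i)

namespace FirstPassage

open Polynomial

theorem isAlgebraic_coeff_of_monic_of_dvd {R S : Type*} [CommRing R] [IsDomain R]
    [CommRing S] [IsDomain S] [Algebra R S] [FaithfulSMul R S] {p : R[X]} (hp : p ≠ 0)
    {q : S[X]} (hq : q.Monic) (h : q ∣ p.map (algebraMap R S)) (i : ℕ) :
    IsAlgebraic R (q.coeff i) := by
  let F := FractionRing R
  let L := FractionRing S
  let : Algebra F L := FractionRing.liftAlgebra R L
  have hpF : p.map (algebraMap R F) ≠ 0 :=
    (Polynomial.map_ne_zero_iff (FaithfulSMul.algebraMap_injective R F)).mpr hp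
  have hdvd : q.map (algebraMap S L) ∣
      (p.map (algebraMap R F) * C (p.map (algebraMap R F)).leadingCoeff⁻¹).map
        (algebraMap F L) := by
    rw [Polynomial.map_mul, Polynomial.map_map, ← IsScalarTower.algebraMap_eq R F L,
      IsScalarTower.algebraMap_eq R S L, ← Polynomial.map_map]
    exact dvd_mul_of_dvd_left (Polynomial.map_dvd _ h) _
  have hint := Polynomial.isIntegral_coeff_of_dvd _ _
    (monic_mul_leadingCoeff_inv hpF) (hq.map (algebraMap S L)) hdvd i
  rw [coeff_map] at hint
  exact (isAlgebraic_algebraMap_iff (FaithfulSMul.algebraMap_injective S L)).mp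
    ((IsFractionRing.isAlgebraic_iff R F L).mpr hint.isAlgebraic)

section Swap

variable {R : Type*} [CommRing R]

/-- The embedding `R⟦t⟧[y] → R[y]⟦t⟧`. -/
noncomputable def swapHom : (PowerSeries R)[X] →+* PowerSeries R[X] :=
  eval₂RingHom (PowerSeries.map C) (PowerSeries.C X)

theorem coeff_swapHom (p : (PowerSeries R)[X]) (n j : ℕ) :
    (PowerSeries.coeff n (swapHom p)).coeff j = PowerSeries.coeff n (p.coeff j) := by
  induction p using Polynomial.induction_on' with
  | add p q hp hq => simp [hp, hq]
  | monomial k a =>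
    simp only [swapHom, coe_eval₂RingHom, eval₂_monomial, ← map_pow, PowerSeries.coeff_mul_C,
      PowerSeries.coeff_map, coeff_monomial, coeff_C_mul_X_pow]
    simp only [eq_comm (a := j)]
    split_ifs <;> simp

/-- A monic polynomial over `R⟦t⟧` which reduces to a power of `y` at `t = 0` divides another one
as soon as it does so in the larger ring `R[y]⟦t⟧`. -/
theorem dvd_of_swapHom_dvd [Nontrivial R] {A K : (PowerSeries R)[X]} (hA : A.Monic)
    (hA0 : PowerSeries.coeff 0 (swapHom A) = X ^ A.natDegree) (h : swapHom A ∣ swapHom K) :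
    A ∣ K := by
  rw [← modByMonic_eq_zero_iff_dvd hA]
  have hdvd : swapHom A ∣ swapHom (K %ₘ A) := by
    rw [modByMonic_eq_sub_mul_div, map_sub, map_mul]
    exact dvd_sub h (dvd_mul_right _ _)
  obtain ⟨E, hE⟩ := hdvd
  have hdeg : ∀ j, A.natDegree ≤ j → (K %ₘ A).coeff j = 0 := fun j hj =>
    coeff_eq_zero_of_degree_lt <| (degree_modByMonic_lt K hA).trans_le <| by
      rw [degree_eq_natDegree hA.ne_zero]; exact_mod_cast hj
  have hE0 : ∀ n, PowerSeries.coeff n E = 0 := by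
    intro n
    induction n using Nat.strong_induction_on with
    | _ n ih =>
      have hn : PowerSeries.coeff n (swapHom (K %ₘ A)) =
          X ^ A.natDegree * PowerSeries.coeff n E := by
        rw [hE, PowerSeries.coeff_mul, Finset.sum_eq_single (0, n), hA0]
        · rintro ⟨i, j⟩ hij hne
          rw [Finset.HasAntidiagonal.mem_antidiagonal] at hij
          have hj : j < n := by
            by_contra hj
            exact hne (by ext <;> simp <;> simp at hij <;> omega)
          simp [ih j hj]
        · simp
      ext m
      have := congrArg (fun q => q.coeff (m + A.natDegree)) hn
      simp only [coeff_X_pow_mul, coeff_swapHom] at this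
      rw [← this, hdeg _ (Nat.le_add_left _ _)]
      simp
  have hE' : E = 0 := PowerSeries.ext fun n => by simpa using hE0 n
  ext j n
  rw [← coeff_swapHom, hE, hE']
  simp

end Swap

section Walk

variable {S : Finset ℤ} (p : ℤ → ℚ)

/-- The position of the walk with steps `w` after `j` rounds. -/
def position {k : ℕ} (w : Fin k → S) (j : ℕ) : ℤ :=
  ∑ i ∈ Finset.univ.filter (fun i : Fin k => (i : ℕ) < j), (w i : ℤ)

theorem position_self {k : ℕ} (w : Fin k → S) : position w k = ∑ i, (w i : ℤ) := by
  simp [position]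

theorem position_snoc {k : ℕ} (w : Fin k → S) (s : S) {j : ℕ} (hj : j ≤ k) :
    position (Fin.snoc w s : Fin (k + 1) → S) j = position w j := by
  simp only [position, Finset.sum_filter, Fin.sum_univ_castSucc, Fin.snoc_castSucc, Fin.snoc_last,
    Fin.val_castSucc, Fin.val_last]
  simp [hj.not_gt]

theorem position_snoc_succ {k : ℕ} (w : Fin k → S) (s : S) :
    position (Fin.snoc w s : Fin (k + 1) → S) (k + 1) = position w k + s := by
  rw [position_self, position_self, Fin.sum_univ_castSucc]
  simp

variable (S) in
/-- The sum of `(∏ p (w i)) * φ (final position)` over the walks of length `k` that satisfy `P` and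
whose position is `≤ 0` before the last round. -/
noncomputable def walkSum (k : ℕ) (P : ℤ → Prop) [DecidablePred P] (φ : ℤ → ℚ[X]) : ℚ[X] :=
  ∑ w ∈ Finset.univ.filter (fun w : Fin k → S =>
    (∀ j : ℕ, j < k → position w j ≤ 0) ∧ P (position w k)),
    C (∏ i, p (w i)) * φ (position w k)

theorem walkSum_add_walkSum (k : ℕ) (φ : ℤ → ℚ[X]) :
    walkSum S p k (· ≤ 0) φ + walkSum S p k (1 ≤ ·) φ = walkSum S p k (fun _ => True) φ := by
  simp only [walkSum, Finset.sum_filter, ← Finset.sum_add_distrib]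
  refine Finset.sum_congr rfl fun w _ => ?_
  by_cases h : ∀ j : ℕ, j < k → position w j ≤ 0
  · by_cases h' : position w k ≤ 0
    · simp [h', show ¬ 1 ≤ position w k by omega]
    · simp [h', show 1 ≤ position w k by omega]
  · simp [h]

theorem walkSum_succ (k : ℕ) (φ : ℤ → ℚ[X]) :
    walkSum S p (k + 1) (fun _ => True) φ =
      walkSum S p k (· ≤ 0) (fun m => ∑ s ∈ S, C (p s) * φ (m + s)) := by
  simp only [walkSum, Finset.sum_filter]
  rw [← (Fin.snocEquiv fun _ => S).sum_comp, Fintype.sum_prod_type_right]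
  refine Finset.sum_congr rfl fun w _ => ?_
  have hiff (s : S) :
      (∀ j : ℕ, j < k + 1 → position (Fin.snoc w s : Fin (k + 1) → S) j ≤ 0) ↔
        (∀ j : ℕ, j < k → position w j ≤ 0) ∧ position w k ≤ 0 := by
    rw [Nat.forall_lt_succ_right, position_snoc w s le_rfl]
    exact and_congr_left' <| forall₂_congr fun j hj => by rw [position_snoc w s hj.le]
  simp only [Fin.snocEquiv, Equiv.coe_fn_mk, hiff, and_true, position_snoc_succ,
    Fin.prod_univ_castSucc, Fin.snoc_castSucc, Fin.snoc_last]
  split_ifs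
  · rw [← Finset.sum_coe_sort S, Finset.mul_sum]
    simp [mul_assoc]
  · simp

theorem walkSum_nonpos_congr (k : ℕ) {φ ψ : ℤ → ℚ[X]} (q : ℚ[X])
    (h : ∀ m ≤ 0, φ m = ψ m * q) :
    walkSum S p k (· ≤ 0) φ = walkSum S p k (· ≤ 0) ψ * q := by
  rw [walkSum, walkSum, Finset.sum_mul]
  refine Finset.sum_congr rfl fun w hw => ?_
  rw [h _ (Finset.mem_filter.mp hw).2.2, mul_assoc]

theorem eval_walkSum_pos (k b : ℕ) :
    (walkSum S p k (1 ≤ ·) fun m => X ^ ((b : ℤ) - m).toNat).eval 1 = hitProb S p k := by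
  simp [walkSum, hitProb, eval_finsetSum, position_self, eval_mul, eval_prod]
  rfl

theorem coeff_walkSum_pos (k : ℕ) {b j : ℕ} (hb : 0 < b) (hj : b ≤ j) :
    (walkSum S p k (1 ≤ ·) fun m => X ^ ((b : ℤ) - m).toNat).coeff j = 0 := by
  rw [walkSum, finsetSum_coeff]
  refine Finset.sum_eq_zero fun w hw => ?_
  have := (Finset.mem_filter.mp hw).2.2
  rw [coeff_C_mul_X_pow, if_neg (by omega)]

theorem walkSum_zero_pos (φ : ℤ → ℚ[X]) : walkSum S p 0 (1 ≤ ·) φ = 0 := by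
  simp [walkSum, position]

theorem walkSum_zero_nonpos (φ : ℤ → ℚ[X]) : walkSum S p 0 (· ≤ 0) φ = φ 0 := by
  simp [walkSum, position]

end Walk


section Factorization

variable (S : Finset ℤ) (p : ℤ → ℚ)

/-- A positive upper bound for the steps. -/
def stepBound : ℕ := ∑ s ∈ S, s.natAbs + 1

variable {S} in
theorem le_stepBound {s : ℤ} (hs : s ∈ S) : s ≤ stepBound S := by
  have := Finset.single_le_sum (f := Int.natAbs) (fun i _ => Nat.zero_le _) hs
  simp only [stepBound]
  omega

/-- The polynomial in `y` whose value at `n` records the final positions `m` of the walks that first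
become positive at round `n`, as `y ^ (stepBound S - m)`. -/
noncomputable def hitPoly (n : ℕ) : ℚ[X] :=
  walkSum S p n (1 ≤ ·) fun m => X ^ ((stepBound S : ℤ) - m).toNat

/-- The polynomial in `y` recording the final positions `m` of the walks of length `n` that
never become positive, as `y ^ (-m)`. -/
noncomputable def stayPoly (n : ℕ) : ℚ[X] :=
  walkSum S p n (· ≤ 0) fun m => X ^ (-m).toNat

/-- The step polynomial `∑ s, p s * y ^ (stepBound S - s)`. -/
noncomputable def stepPoly : ℚ[X] :=
  ∑ s ∈ S, C (p s) * X ^ ((stepBound S : ℤ) - s).toNat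

theorem stayPoly_add_hitPoly (n : ℕ) :
    stayPoly S p (n + 1) * X ^ stepBound S + hitPoly S p (n + 1) =
      stayPoly S p n * stepPoly S p := by
  rw [stayPoly, stayPoly, hitPoly,
    ← walkSum_nonpos_congr p (n + 1) (φ := fun m => X ^ ((stepBound S : ℤ) - m).toNat),
    walkSum_add_walkSum, walkSum_succ, walkSum_nonpos_congr]
  · intro m hm
    rw [stepPoly, Finset.mul_sum]
    refine Finset.sum_congr rfl fun s hs => ?_
    have := le_stepBound hs
    rw [mul_left_comm, ← pow_add]
    congr 2
    omega
  · intro m hm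
    rw [← pow_add]
    congr 1
    omega

/-- The coefficient of `y ^ j` in the generating function `∑ n, hitPoly S p n * t ^ n`. -/
noncomputable def hitSeries (j : ℕ) : PowerSeries ℚ :=
  PowerSeries.mk fun n => (hitPoly S p n).coeff j

/-- The monic factor of the kernel, `y ^ stepBound S - ∑ n, hitPoly S p n * t ^ n`. -/
noncomputable def ladderPoly : (PowerSeries ℚ)[X] :=
  X ^ stepBound S - ∑ j ∈ Finset.range (stepBound S), monomial j (hitSeries S p j)

/-- The kernel `y ^ stepBound S - t * stepPoly S p`. -/
noncomputable def kernelPoly : ℚ[X][X] :=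
  X ^ stepBound S - C X * (stepPoly S p).map C

theorem degree_sum_hitSeries_lt :
    (∑ j ∈ Finset.range (stepBound S), monomial j (hitSeries S p j)).degree <
      (stepBound S : WithBot ℕ) := by
  refine (degree_sum_le _ _).trans_lt <| (Finset.sup_lt_iff (WithBot.bot_lt_coe _)).mpr ?_
  intro j hj
  exact (degree_monomial_le _ _).trans_lt (by exact_mod_cast Finset.mem_range.mp hj)

theorem ladderPoly_monic : (ladderPoly S p).Monic :=
  monic_X_pow_sub (degree_sum_hitSeries_lt S p)

theorem natDegree_ladderPoly : (ladderPoly S p).natDegree = stepBound S := by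
  refine natDegree_eq_of_degree_eq_some ?_
  rw [ladderPoly, degree_sub_eq_left_of_degree_lt] <;> rw [degree_X_pow]
  exact degree_sum_hitSeries_lt S p

theorem coeff_ladderPoly {j : ℕ} (hj : j < stepBound S) :
    (ladderPoly S p).coeff j = -hitSeries S p j := by
  simp [ladderPoly, coeff_X_pow, coeff_monomial, hj, hj.ne]

theorem coeff_hitPoly_eq_zero (n : ℕ) {j : ℕ} (hj : stepBound S ≤ j) :
    (hitPoly S p n).coeff j = 0 :=
  coeff_walkSum_pos p n (Nat.succ_pos _) hj

theorem swapHom_ladderPoly :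
    swapHom (ladderPoly S p) =
      PowerSeries.C (X ^ stepBound S) - PowerSeries.mk (hitPoly S p) := by
  ext n j
  rw [coeff_swapHom]
  have hX : PowerSeries.coeff n ((X ^ stepBound S : (PowerSeries ℚ)[X]).coeff j) =
      (PowerSeries.coeff n (PowerSeries.C (X ^ stepBound S : ℚ[X]))).coeff j := by
    rw [← coeff_swapHom]
    simp [swapHom]
  rw [ladderPoly, coeff_sub, map_sub, map_sub, coeff_sub, hX, PowerSeries.coeff_mk]
  congr 1
  simp only [finsetSum_coeff, coeff_monomial, Finset.sum_ite_eq', Finset.mem_range]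
  split_ifs with hj
  · simp [hitSeries]
  · simp [coeff_hitPoly_eq_zero S p n (not_lt.mp hj)]

theorem swapHom_kernelPoly :
    swapHom ((kernelPoly S p).map (algebraMap ℚ[X] (PowerSeries ℚ))) =
      PowerSeries.C (X ^ stepBound S) - PowerSeries.X * PowerSeries.C (stepPoly S p) := by
  simp [kernelPoly, stepPoly, swapHom, Polynomial.map_sum, eval₂_finsetSum,
    PowerSeries.algebraMap_apply']

theorem mk_stayPoly_mul_kernel :
    PowerSeries.mk (stayPoly S p) *
        (PowerSeries.C (X ^ stepBound S) - PowerSeries.X * PowerSeries.C (stepPoly S p)) =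
      PowerSeries.C (X ^ stepBound S) - PowerSeries.mk (hitPoly S p) := by
  rw [mul_sub, mul_left_comm]
  refine PowerSeries.ext fun n => ?_
  cases n with
  | zero => simp [stayPoly, hitPoly, walkSum_zero_pos, walkSum_zero_nonpos]
  | succ n =>
    simp only [map_sub, PowerSeries.coeff_mul_C, PowerSeries.coeff_succ_X_mul,
      PowerSeries.coeff_mk, PowerSeries.coeff_C, ← stayPoly_add_hitPoly]
    simp

theorem ladderPoly_dvd :
    ladderPoly S p ∣ (kernelPoly S p).map (algebraMap ℚ[X] (PowerSeries ℚ)) := by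
  refine dvd_of_swapHom_dvd (ladderPoly_monic S p) ?_ ?_
  · rw [swapHom_ladderPoly, natDegree_ladderPoly]
    simp [hitPoly, walkSum_zero_pos]
  · have hunit : IsUnit (PowerSeries.mk (stayPoly S p)) := by
      rw [PowerSeries.isUnit_iff_constantCoeff]
      simp [stayPoly, walkSum_zero_nonpos]
    rw [swapHom_ladderPoly, swapHom_kernelPoly, ← mk_stayPoly_mul_kernel]
    exact hunit.mul_left_dvd.mpr dvd_rfl

theorem kernelPoly_ne_zero : kernelPoly S p ≠ 0 := by
  intro h
  have := congrArg (Polynomial.map (evalRingHom (0 : ℚ))) h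
  simp [kernelPoly] at this

theorem mk_hitProb_eq_sum :
    (PowerSeries.mk fun k => hitProb S p k) =
      ∑ j ∈ Finset.range (stepBound S), hitSeries S p j := by
  ext n
  have hdeg : (hitPoly S p n).natDegree < stepBound S := by
    refine Nat.lt_succ_of_le (natDegree_le_iff_coeff_eq_zero.mpr fun j hj => ?_)
    exact coeff_hitPoly_eq_zero S p n hj
  rw [PowerSeries.coeff_mk, ← eval_walkSum_pos p n (stepBound S), ← hitPoly,
    eval_eq_sum_range' hdeg]
  simp [hitSeries]

instance faithfulSMul_powerSeries : FaithfulSMul ℚ[X] (PowerSeries ℚ) := by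
  rw [faithfulSMul_iff_algebraMap_injective]
  intro f g h
  simpa [PowerSeries.algebraMap_apply'] using h

theorem isAlgebraic_mk_hitProb :
    IsAlgebraic ℚ[X] (PowerSeries.mk fun k => hitProb S p k) := by
  rw [mk_hitProb_eq_sum]
  refine (Subalgebra.algebraicClosure ℚ[X] (PowerSeries ℚ)).sum_mem fun j hj => ?_
  have := isAlgebraic_coeff_of_monic_of_dvd (kernelPoly_ne_zero S p) (ladderPoly_monic S p)
    (ladderPoly_dvd S p) j
  rw [coeff_ladderPoly S p (Finset.mem_range.mp hj)] at this
  exact neg_neg (hitSeries S p j) ▸ this.neg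

end Factorization

end FirstPassage

/-- For any die on nonzero integers with rational probabilities and positive
drift, the probability generating function `f(t) = Σ_k a(k) t^k` of the first-passage time
to a strictly positive position is algebraic over `ℚ[t]`. -/
theorem first_passage_pgf_is_algebraic (S : Finset ℤ) (hS : 0 ∉ S)
    (p : ℤ → ℚ) (hp : ∀ s ∈ S, 0 < p s) (hp1 : ∑ s ∈ S, p s = 1)
    (hdrift : 0 < ∑ s ∈ S, (s : ℚ) * p s) :
    ∃ (d : ℕ), 1 ≤ d ∧ ∃ c : Fin (d + 1) → Polynomial ℚ,
      (∃ i, c i ≠ 0) ∧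
      ∑ i : Fin (d + 1), ((c i : PowerSeries ℚ) *
        (PowerSeries.mk fun k => hitProb S p k) ^ (i : ℕ)) = 0 := by
  obtain ⟨q, hq, hqf⟩ := FirstPassage.isAlgebraic_mk_hitProb S p
  refine ⟨q.natDegree + 1, by omega, fun i => q.coeff i,
    ⟨⟨q.natDegree, by omega⟩, by simpa using hq⟩, ?_⟩
  rw [Polynomial.aeval_eq_sum_range' (n := q.natDegree + 1 + 1) (by omega)] at hqf
  rw [← hqf, ← Fin.sum_univ_eq_sum_range
    (fun i => q.coeff i • (PowerSeries.mk fun k => hitProb S p k) ^ i)]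
  refine Finset.sum_congr rfl fun i _ => ?_
  simp [Algebra.smul_def, PowerSeries.algebraMap_apply']
end

section
/- Let a die on nonzero integers be given with rational probabilities: a finite set S of nonzero integers with p_s ∈ ℚ, p_s > 0 for s ∈ S, Σ_{s∈S} p_s = 1, and positive drift Σ_{s∈S} s·p_s > 0. Let a(k) be the probability that the walk first reaches a strictly positive position at exactly round k. Then for every positive integer r the series Σ_{k≥1} k^r·a(k) converges, and its sum (in particular the expectation Σ_k k·a(k), and hence also the variance and all higher moments of the duration) is a real algebraic number over ℚ. -/
open Polynomial in
theorem isAlgebraic_eval_one_of_dvd_map {R D : Type*} [CommRing R] [IsDomain R] [CommRing D]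
    [IsDomain D] [Algebra R D] {Q : R[X]}
    (hQ : Q ≠ 0) {E : D[X]} (hE : E.coeff 0 = 1) (hdvd : E ∣ Q.map (algebraMap R D)) :
    IsAlgebraic R (E.eval 1) := by
  let Ω := AlgebraicClosure (FractionRing D)
  have hΩ : Function.Injective (algebraMap D Ω) := by
    rw [IsScalarTower.algebraMap_eq D (FractionRing D) Ω]
    exact (algebraMap (FractionRing D) Ω).injective.comp (IsFractionRing.injective D _)
  rw [← isAlgebraic_algebraMap_iff (S := D) hΩ]
  set e := E.map (algebraMap D Ω) with he
  have hev : algebraMap D Ω (E.eval 1) = e.eval 1 := by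
    rw [he, eval_map, ← map_one (algebraMap D Ω), eval₂_at_apply]
  have h0 : e.coeff 0 = 1 := by simp [he, hE]
  have hs : e.Splits := IsAlgClosed.splits e
  have he0 : e ≠ 0 := by rintro h; simp [h] at h0
  have hroots : ∀ x ∈ e.roots, IsAlgebraic R x := by
    intro x hx
    refine ⟨Q, hQ, ?_⟩
    have hd : e ∣ Q.map (algebraMap R Ω) := by
      rw [IsScalarTower.algebraMap_eq R D Ω, ← Polynomial.map_map]
      exact Polynomial.map_dvd _ hdvd
    have := (isRoot_of_mem_roots hx).dvd hd
    rwa [IsRoot, eval_map_algebraMap] at this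
  have hmem : ∀ s : Multiset Ω, (∀ x ∈ s, IsAlgebraic R x) → IsAlgebraic R s.prod := fun s hs =>
    (Subalgebra.algebraicClosure R Ω).multiset_prod_mem (m := s) hs
  have hc : IsAlgebraic R ((-1) ^ e.natDegree * e.roots.prod) :=
    ((isAlgebraic_one (R := R) (A := Ω)).neg.pow _).mul (hmem _ hroots)
  have hc' : IsAlgebraic R e.leadingCoeff := by
    have h := hs.coeff_zero_eq_leadingCoeff_mul_prod_roots
    rw [h0, mul_right_comm] at h
    rw [eq_inv_of_mul_eq_one_right h.symm]
    exact hc.inv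
  rw [hev, hs.eval_eq_prod_roots]
  refine hc'.mul (hmem _ ?_)
  simp only [Multiset.mem_map, forall_exists_index, and_imp]
  rintro _ x hx rfl
  exact isAlgebraic_one.sub (hroots x hx)

open PowerSeries in
theorem exists_swap_of_natDegree_le {K : Type*} [CommRing K] (q : (Polynomial K)⟦X⟧) (d : ℕ)
    (hq : ∀ n, (coeff n q).natDegree ≤ d) :
    ∃ Q : Polynomial K⟦X⟧, ∀ j n, coeff n (Q.coeff j) = (coeff n q).coeff j := by
  refine ⟨∑ j ∈ Finset.range (d + 1),
    Polynomial.monomial j (mk fun n => (coeff n q).coeff j), fun j n => ?_⟩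
  simp only [Polynomial.finsetSum_coeff, Polynomial.coeff_monomial, Finset.sum_ite_eq',
    Finset.mem_range]
  split_ifs with h
  · simp
  · rw [Polynomial.coeff_eq_zero_of_natDegree_lt (by have := hq n; omega), map_zero]

open PowerSeries in
theorem swap_mul {K : Type*} [CommRing K] {g e q : (Polynomial K)⟦X⟧} {G E Q : Polynomial K⟦X⟧}
    (hG : ∀ j n, coeff n (G.coeff j) = (coeff n g).coeff j)
    (hE : ∀ j n, coeff n (E.coeff j) = (coeff n e).coeff j)
    (hQ : ∀ j n, coeff n (Q.coeff j) = (coeff n q).coeff j) (h : q = g * e) : Q = G * E := by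
  ext j n
  rw [hQ, h, coeff_mul, Polynomial.finsetSum_coeff, Polynomial.coeff_mul, map_sum]
  simp only [Polynomial.coeff_mul, coeff_mul, hG, hE]
  exact Finset.sum_comm

open LaurentPolynomial in
theorem coeff_toLaurent_natCast {K : Type*} [CommRing K] (q : Polynomial K) (N : ℕ) :
    (Polynomial.toLaurent q).coeff (N : ℤ) = q.coeff N := by
  rw [coeff_toLaurent]
  exact Finsupp.mapDomain_apply Nat.castEmbedding.injective q.toFinsupp.coeff N

open LaurentPolynomial in
theorem coeff_T_mul_invert_toLaurent {K : Type*} [CommRing K] (b : ℕ) (g : Polynomial K) {i : ℤ}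
    (hi : b < i) : (T b * invert (Polynomial.toLaurent g)).coeff i = 0 := by
  induction g using Polynomial.induction_on' with
  | add p q hp hq => rw [map_add, map_add, mul_add, AddMonoidAlgebra.coeff_add,
      Finsupp.add_apply, hp, hq, add_zero]
  | monomial n c =>
    rw [← Polynomial.C_mul_X_pow_eq_monomial, Polynomial.toLaurent_C_mul_X_pow, map_mul, invert_C,
      invert_T, mul_left_comm, ← T_add, ← single_eq_C_mul_T]
    simp only [AddMonoidAlgebra.coeff_single]
    exact Finsupp.single_eq_of_ne (by omega)

open LaurentPolynomial in
theorem natDegree_le_of_toLaurent_eq {K : Type*} [CommRing K] {b : ℕ} {q g : Polynomial K}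
    (h : Polynomial.toLaurent q = T b * invert (Polynomial.toLaurent g)) : q.natDegree ≤ b := by
  rw [Polynomial.natDegree_le_iff_coeff_eq_zero]
  intro N hN
  have := coeff_T_mul_invert_toLaurent b g (i := N) (by exact_mod_cast hN)
  rwa [← h, coeff_toLaurent_natCast] at this

open scoped LaurentPolynomial in
open LaurentPolynomial (T invert T_add invert_T) in
open PowerSeries in
theorem isAlgebraic_mk_eval_one {K : Type*} [Field K] {f h : ℕ → Polynomial K} {P : K[T;T⁻¹]}
    {Pp Pm : Polynomial K} {a b : ℕ} (hf0 : f 0 = 1) (hh0 : h 0 = 0)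
    (hhc : ∀ n, (h n).coeff 0 = 0) (hPp : Polynomial.toLaurent Pp = T a * P)
    (hPm : P = T b * invert (Polynomial.toLaurent Pm))
    (hrec : ∀ n, Polynomial.toLaurent (h (n + 1)) + invert (Polynomial.toLaurent (f (n + 1))) =
      P * invert (Polynomial.toLaurent (f n))) :
    IsAlgebraic (Polynomial K) (PowerSeries.mk fun n => (h n).eval 1) := by
  let τ : Polynomial K →+* K[T;T⁻¹] := Polynomial.toLaurent
  let ν : Polynomial K →+* K[T;T⁻¹] := (invert : K[T;T⁻¹] ≃ₐ[K] K[T;T⁻¹]).toRingHom.comp τ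
  have hνdef : ∀ q, ν q = invert (Polynomial.toLaurent q) := fun _ => rfl
  have hτdef : ∀ q, τ q = Polynomial.toLaurent q := fun _ => rfl
  -- the kernel equation and its factorisation
  have hkernel : PowerSeries.map ν (mk f) * (1 - X * C P) = 1 - PowerSeries.map τ (mk h) := by
    ext1 n
    cases n with
    | zero =>
      simp only [mul_sub, mul_left_comm _ X, map_sub, coeff_zero_X_mul, mul_one, coeff_map,
        coeff_mk, coeff_zero_one, hf0, hh0, map_one, map_zero]
    | succ n =>
      simp only [mul_sub, mul_left_comm _ X, map_sub, coeff_succ_X_mul, mul_one, coeff_map,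
        coeff_mk, coeff_mul_C, coeff_one, Nat.succ_ne_zero, if_false]
      rw [hνdef, hνdef, mul_comm _ P, ← hrec n, hτdef (h (n + 1))]
      ring
  obtain ⟨g', hg'⟩ : ∃ g', mk f * g' = 1 := by
    apply IsUnit.exists_right_inv
    rw [PowerSeries.isUnit_iff_constantCoeff]
    rw [← coeff_zero_eq_constantCoeff_apply, coeff_mk, hf0]
    exact isUnit_one
  obtain ⟨e', he'⟩ : ∃ e', (1 - mk h) * e' = 1 := by
    apply IsUnit.exists_right_inv
    rw [PowerSeries.isUnit_iff_constantCoeff]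
    rw [← coeff_zero_eq_constantCoeff_apply, map_sub, coeff_mk, hh0, coeff_zero_one, sub_zero]
    exact isUnit_one
  set q : (Polynomial K)⟦X⟧ := C (Polynomial.X ^ a) - X * C Pp with hq
  have hmapq : PowerSeries.map τ q = C (T a) * (1 - X * C P) := by
    simp only [hq, map_sub, map_mul, map_C, map_X, hτdef, hPp, Polynomial.toLaurent_X_pow]
    ring
  have hdual : PowerSeries.map τ (q * e') = C (T a) * PowerSeries.map ν g' := by
    have h1 : PowerSeries.map ν (mk f) * PowerSeries.map ν g' = 1 := by
      rw [← map_mul, hg', map_one]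
    have h2 : (1 - PowerSeries.map τ (mk h)) * PowerSeries.map τ e' = 1 := by
      rw [← map_one (PowerSeries.map τ), ← map_sub, ← map_mul, he']
    rw [map_mul, hmapq]
    linear_combination (- C (T a) * (1 - X * C P) * PowerSeries.map τ e') * h1 +
      (C (T a) * PowerSeries.map ν g' * PowerSeries.map τ e') * hkernel +
      (C (T a) * PowerSeries.map ν g') * h2
  have hfactor : q = (q * e') * (1 - mk h) := by
    rw [mul_assoc, mul_comm e', he', mul_one]
  -- both factors are polynomials in the space variable
  have hdeg1 : ∀ n, (coeff n (q * e')).natDegree ≤ a := fun n => by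
    apply natDegree_le_of_toLaurent_eq (g := coeff n g')
    have := congrArg (coeff n) hdual
    rwa [coeff_map, coeff_C_mul, coeff_map] at this
  have hdeg2 : ∀ n, (coeff n (1 - mk h)).natDegree ≤ b := fun n => by
    cases n with
    | zero => simp [hh0]
    | succ n =>
      apply natDegree_le_of_toLaurent_eq (g := Polynomial.X ^ b * f (n + 1) - Pm * f n)
      have h1 := hrec n
      rw [hPm] at h1
      have h2 : (T (b : ℤ) : K[T;T⁻¹]) * T (-(b : ℤ)) = 1 := by rw [← T_add]; simp
      simp only [map_sub, map_mul, Polynomial.toLaurent_X_pow, invert_T, coeff_mk, coeff_one,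
        Nat.succ_ne_zero, if_false, map_zero]
      linear_combination -h1 - invert (Polynomial.toLaurent (f (n + 1))) * h2
  obtain ⟨G, hG⟩ := exists_swap_of_natDegree_le _ a hdeg1
  obtain ⟨E, hE⟩ := exists_swap_of_natDegree_le _ b hdeg2
  let Q : Polynomial (Polynomial K) :=
    Polynomial.X ^ a - Polynomial.C Polynomial.X * Pp.map Polynomial.C
  have hQ : ∀ j n, coeff n ((Q.map (algebraMap (Polynomial K) K⟦X⟧)).coeff j) =
      (coeff n q).coeff j := by
    intro j n
    rw [Polynomial.coeff_map, PowerSeries.algebraMap_apply']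
    simp only [Q, hq, Polynomial.coeff_sub, Polynomial.coeff_C_mul, Polynomial.coeff_map,
      Polynomial.coeff_X_pow, coeff_map, Polynomial.coeff_coe, map_sub, Algebra.algebraMap_self,
      RingHom.id_apply]
    cases n with
    | zero =>
      rw [coeff_zero_X_mul, coeff_zero_C, Polynomial.coeff_X_pow, Polynomial.coeff_X_mul_zero]
      split_ifs <;> simp
    | succ n =>
      rw [coeff_succ_X_mul, coeff_C, coeff_C, if_neg (Nat.succ_ne_zero n),
        Polynomial.coeff_X_mul, Polynomial.coeff_C]
      split_ifs <;> simp [Polynomial.coeff_one]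
  have hQ0 : Q ≠ 0 := by
    intro h0
    have := congrArg (fun q => (Polynomial.coeff q a).eval 0) h0
    simp [Q] at this
  have hdvd : E ∣ Q.map (algebraMap (Polynomial K) K⟦X⟧) :=
    ⟨G, by rw [mul_comm]; exact swap_mul hG hE hQ hfactor⟩
  have hE0 : E.coeff 0 = 1 := by
    ext n
    rw [hE, map_sub, Polynomial.coeff_sub, coeff_mk, hhc, sub_zero, coeff_one, coeff_one]
    split_ifs <;> simp
  have hE1 : E.eval 1 = 1 - mk fun n => (h n).eval 1 := by
    ext n
    have h1 : (1 - mk fun n => (h n).eval 1 : K⟦X⟧).coeff n = (coeff n (1 - mk h)).eval 1 := by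
      simp only [map_sub, coeff_one, coeff_mk, Polynomial.eval_sub]
      split_ifs <;> simp
    rw [h1, Polynomial.eval_eq_sum_range' (n := max E.natDegree b + 1)
      (by omega), Polynomial.eval_eq_sum_range' (n := max E.natDegree b + 1)
      (by have := hdeg2 n; omega)]
    simp [hE]
  have := isAlgebraic_eval_one_of_dvd_map hQ0 hE0 hdvd
  rw [hE1] at this
  simpa using isAlgebraic_one.sub this

open PowerSeries in
theorem isAlgebraic_constantCoeff {k L : Type*} [Field k] [Field L] [Algebra k L] {x : L⟦X⟧}
    (hx : IsAlgebraic (Polynomial k) x) : IsAlgebraic k (constantCoeff x) := by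
  obtain ⟨p, hp0, hp⟩ := hx
  obtain ⟨c, hc, hndvd⟩ := (FiniteMultiplicity.of_not_isUnit
    (a := (Polynomial.C Polynomial.X : Polynomial (Polynomial k)))
    (by rw [Polynomial.isUnit_C]; exact Polynomial.not_isUnit_X) hp0).exists_eq_pow_mul_and_not_dvd
  have hcx : Polynomial.aeval x c = 0 := by
    rw [hc, map_mul, map_pow, Polynomial.aeval_C] at hp
    refine (mul_eq_zero.mp hp).resolve_left (pow_ne_zero _ ?_)
    simp [PowerSeries.algebraMap_apply', PowerSeries.X_ne_zero]
  refine ⟨c.map Polynomial.constantCoeff, fun h => hndvd ?_, ?_⟩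
  · rw [Polynomial.C_dvd_iff_dvd_coeff]
    intro i
    rw [Polynomial.X_dvd_iff]
    simpa using congrArg (Polynomial.coeff · i) h
  · have h := congrArg (constantCoeff (R := L)) hcx
    rw [Polynomial.aeval_def, Polynomial.hom_eval₂, map_zero] at h
    rw [Polynomial.aeval_def, Polynomial.eval₂_map, ← h]
    congr 1

open PowerSeries in
theorem isAlgebraic_coeff {k L : Type*} [Field k] [Field L] [Algebra k L] (n : ℕ) {x : L⟦X⟧}
    (hx : IsAlgebraic (Polynomial k) x) : IsAlgebraic k (coeff n x) := by
  induction n generalizing x with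
  | zero => simpa using isAlgebraic_constantCoeff hx
  | succ n ih =>
    have hconst : IsAlgebraic (Polynomial k) (C (constantCoeff x)) := by
      obtain ⟨p, hp0, hp⟩ := isAlgebraic_constantCoeff hx
      refine ⟨p.map Polynomial.C, (Polynomial.map_ne_zero_iff Polynomial.C_injective).mpr hp0, ?_⟩
      have h := congrArg (C (R := L)) hp
      rw [Polynomial.aeval_def, Polynomial.hom_eval₂, map_zero] at h
      rw [Polynomial.aeval_def, Polynomial.eval₂_map, ← h]
      congr 1
      ext1 a
      simp [PowerSeries.algebraMap_apply']
    have hX : IsAlgebraic (Polynomial k) (X : L⟦X⟧) := by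
      have := isAlgebraic_algebraMap (A := L⟦X⟧) (Polynomial.X : Polynomial k)
      simpa [PowerSeries.algebraMap_apply'] using this
    let y : L⟦X⟧ := mk fun m => coeff (m + 1) x
    have hxy : X * y = x - C (constantCoeff x) := by
      rw [eq_sub_iff_add_eq, ← eq_X_mul_shift_add_const x]
    have hy : IsAlgebraic (Polynomial k) y :=
      .of_mul (mem_nonZeroDivisors_of_ne_zero X_ne_zero) hX (hxy ▸ hx.sub hconst)
    simpa [y] using ih hy

theorem summable_and_tsum_choose_mul_convolution {f g : ℕ → ℝ} (j : ℕ)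
    (hf : ∀ i, Summable fun k : ℕ => ‖(k.choose i : ℝ) * f k‖)
    (hg : ∀ i, Summable fun k : ℕ => ‖(k.choose i : ℝ) * g k‖) :
    Summable (fun k : ℕ => ‖(k.choose j : ℝ) *
      ∑ mn ∈ Finset.HasAntidiagonal.antidiagonal k, f mn.1 * g mn.2‖) ∧
    ∑ il ∈ Finset.HasAntidiagonal.antidiagonal j,
      (∑' k : ℕ, (k.choose il.1 : ℝ) * f k) * (∑' k : ℕ, (k.choose il.2 : ℝ) * g k) =
    ∑' k : ℕ, (k.choose j : ℝ) *
      ∑ mn ∈ Finset.HasAntidiagonal.antidiagonal k, f mn.1 * g mn.2 := by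
  have h : ∀ k : ℕ, (k.choose j : ℝ) *
      ∑ mn ∈ Finset.HasAntidiagonal.antidiagonal k, f mn.1 * g mn.2 =
      ∑ il ∈ Finset.HasAntidiagonal.antidiagonal j,
        ∑ mn ∈ Finset.HasAntidiagonal.antidiagonal k,
          (mn.1.choose il.1 * f mn.1) * (mn.2.choose il.2 * g mn.2) := fun k => by
    rw [Finset.sum_comm, Finset.mul_sum]
    refine Finset.sum_congr rfl fun mn hmn => ?_
    rw [← Finset.HasAntidiagonal.mem_antidiagonal.mp hmn, Nat.add_choose_eq]
    push_cast
    rw [Finset.sum_mul]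
    exact Finset.sum_congr rfl fun il _ => by ring
  have hs : ∀ il : ℕ × ℕ, Summable fun k : ℕ =>
      ‖∑ mn ∈ Finset.HasAntidiagonal.antidiagonal k,
        (mn.1.choose il.1 * f mn.1) * (mn.2.choose il.2 * g mn.2)‖ := fun il => by
    have := summable_norm_sum_mul_antidiagonal_of_summable_norm (hf il.1) (hg il.2)
    exact this
  simp only [h]
  refine ⟨.of_nonneg_of_le (fun _ => norm_nonneg _) (fun k => norm_sum_le _ _)
    (summable_sum fun il _ => hs il), ?_⟩
  rw [Summable.tsum_finsetSum fun il _ => (hs il).of_norm]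
  exact Finset.sum_congr rfl fun il _ => by
    have := tsum_mul_tsum_eq_tsum_sum_antidiagonal_of_summable_norm (hf il.1) (hg il.2)
    exact this

/-- Pairs consisting of a power series and its re-expansion at the point `1`, where the
coefficients of the first are summable against all binomial coefficients. -/
def reexpansion : Subring (PowerSeries ℚ × PowerSeries ℝ) where
  carrier := {x | ∀ j, Summable (fun k : ℕ => ‖(k.choose j : ℝ) * (x.1.coeff k : ℝ)‖) ∧
    x.2.coeff j = ∑' k : ℕ, (k.choose j : ℝ) * (x.1.coeff k : ℝ)}
  zero_mem' j := by simp
  one_mem' j := by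
    have h : ∀ k ∉ ({0} : Finset ℕ),
        (k.choose j : ℝ) * (((1 : PowerSeries ℚ).coeff k : ℚ) : ℝ) = 0 := by
      intro k hk
      simp_all [PowerSeries.coeff_one]
    refine ⟨summable_of_ne_finset_zero (s := {0}) fun k hk => norm_eq_zero.mpr (h k hk), ?_⟩
    simp only [Prod.fst_one, Prod.snd_one]
    rw [tsum_eq_sum h]
    cases j <;> simp [PowerSeries.coeff_one]
  add_mem' {x y} hx hy j := by
    have h : ∀ k : ℕ, (k.choose j : ℝ) * ((x + y).1.coeff k : ℝ) =
        k.choose j * (x.1.coeff k : ℝ) + k.choose j * (y.1.coeff k : ℝ) := fun k => by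
      simp [mul_add]
    simp only [h]
    refine ⟨.of_nonneg_of_le (fun _ => norm_nonneg _) (fun k => norm_add_le _ _)
      ((hx j).1.add (hy j).1), ?_⟩
    rw [((hx j).1.of_norm).tsum_add (hy j).1.of_norm, ← (hx j).2, ← (hy j).2]
    simp
  neg_mem' {x} hx j := by
    have h : ∀ k : ℕ, (k.choose j : ℝ) * ((-x).1.coeff k : ℝ) =
        -(k.choose j * (x.1.coeff k : ℝ)) := fun k => by simp
    simp only [h, norm_neg, tsum_neg, ← (hx j).2]
    exact ⟨(hx j).1, by simp⟩
  mul_mem' {x y} hx hy j := by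
    have h := summable_and_tsum_choose_mul_convolution j (fun i => (hx i).1) fun i => (hy i).1
    simp only [Prod.fst_mul, Prod.snd_mul, PowerSeries.coeff_mul, Rat.cast_sum, Rat.cast_mul,
      (hx _).2, (hy _).2]
    exact h

theorem C_mem_reexpansion (q : ℚ) : (PowerSeries.C q, PowerSeries.C (q : ℝ)) ∈ reexpansion := by
  intro j
  have h : ∀ k ∉ ({0} : Finset ℕ),
      (k.choose j : ℝ) * ((PowerSeries.C q).coeff k : ℝ) = 0 := by
    intro k hk
    simp_all [PowerSeries.coeff_C]
  refine ⟨summable_of_ne_finset_zero (s := {0}) fun k hk => norm_eq_zero.mpr (h k hk), ?_⟩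
  rw [tsum_eq_sum h]
  cases j <;> simp [PowerSeries.coeff_C]

theorem X_mem_reexpansion :
    ((PowerSeries.X, 1 + PowerSeries.X) : PowerSeries ℚ × PowerSeries ℝ) ∈ reexpansion := by
  intro j
  have h : ∀ k ∉ ({1} : Finset ℕ),
      (k.choose j : ℝ) * (((PowerSeries.X : PowerSeries ℚ).coeff k : ℚ) : ℝ) = 0 := by
    intro k hk
    simp_all [PowerSeries.coeff_X]
  refine ⟨summable_of_ne_finset_zero (s := {1}) fun k hk => norm_eq_zero.mpr (h k hk), ?_⟩
  rw [tsum_eq_sum h]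
  rcases j with _ | _ | j <;>
    simp [PowerSeries.coeff_one, PowerSeries.coeff_X, Nat.choose_eq_zero_of_lt]

theorem isAlgebraic_of_mem_reexpansion {x : PowerSeries ℚ} {y : PowerSeries ℝ}
    (hxy : (x, y) ∈ reexpansion) (hx : IsAlgebraic (Polynomial ℚ) x) :
    IsAlgebraic (Polynomial ℚ) y := by
  obtain ⟨p, hp0, hp⟩ := hx
  let φ : Polynomial ℚ →+* PowerSeries ℚ × PowerSeries ℝ := Polynomial.eval₂RingHom
    ((PowerSeries.C (R := ℚ)).prod ((PowerSeries.C (R := ℝ)).comp (algebraMap ℚ ℝ)))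
    (PowerSeries.X, 1 + PowerSeries.X)
  have hφ : ∀ q, φ q ∈ reexpansion := fun q => by
    simp only [φ, Polynomial.coe_eval₂RingHom, Polynomial.eval₂_eq_sum, Polynomial.sum]
    exact sum_mem fun i _ => mul_mem (C_mem_reexpansion _) (pow_mem X_mem_reexpansion _)
  have hmem : p.eval₂ φ (x, y) ∈ reexpansion := by
    rw [Polynomial.eval₂_eq_sum, Polynomial.sum]
    exact sum_mem fun i _ => mul_mem (hφ _) (pow_mem hxy _)
  have hfst : (p.eval₂ φ (x, y)).1 = 0 := by
    have h := Polynomial.hom_eval₂ p φ (RingHom.fst _ _) (x, y)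
    rw [← hp, Polynomial.aeval_def]
    refine h.trans ?_
    congr 1
    ext <;> simp [φ, PowerSeries.algebraMap_apply']
  have hsnd : (p.eval₂ φ (x, y)).2 = 0 := by
    ext j
    rw [(hmem j).2, hfst]
    simp
  refine ⟨p.map (Polynomial.compRingHom (1 + Polynomial.X)), ?_, ?_⟩
  · rw [Polynomial.map_ne_zero_iff]
    · exact hp0
    · intro f g hfg
      have := congrArg (Polynomial.comp · (Polynomial.X - 1)) hfg
      simpa [Polynomial.comp_assoc] using this
  · have h := Polynomial.hom_eval₂ p φ (RingHom.snd _ _) (x, y)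
    rw [Polynomial.aeval_def, Polynomial.eval₂_map, ← hsnd]
    refine Eq.trans ?_ h.symm
    congr 1
    ext <;> simp [φ, PowerSeries.algebraMap_apply']

theorem exists_hasSum_isAlgebraic_of_mem_reexpansion {x : PowerSeries ℚ} {y : PowerSeries ℝ}
    (hxy : (x, y) ∈ reexpansion) (hx : IsAlgebraic (Polynomial ℚ) x) (r : ℕ) :
    ∃ s : ℝ, HasSum (fun k : ℕ => (k : ℝ) ^ r * (x.coeff k : ℝ)) s ∧ IsAlgebraic ℚ s := by
  suffices h : ∀ j : ℕ, ∃ s : ℝ,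
      HasSum (fun k : ℕ => (k : ℝ) ^ r * (k.choose j * (x.coeff k : ℝ))) s ∧ IsAlgebraic ℚ s by
    simpa using h 0
  induction r with
  | zero =>
    intro j
    refine ⟨y.coeff j, ?_, isAlgebraic_coeff j (isAlgebraic_of_mem_reexpansion hxy hx)⟩
    simp only [pow_zero, one_mul]
    rw [(hxy j).2]
    exact (hxy j).1.of_norm.hasSum
  | succ r ih =>
    intro j
    obtain ⟨s, hs, hsa⟩ := ih (j + 1)
    obtain ⟨t, ht, hta⟩ := ih j
    refine ⟨(j + 1) * s + j * t, ?_, ?_⟩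
    · have h : ∀ k : ℕ, (k : ℝ) ^ (r + 1) * (k.choose j * (x.coeff k : ℝ)) =
          (j + 1) * ((k : ℝ) ^ r * (k.choose (j + 1) * (x.coeff k : ℝ))) +
            j * ((k : ℝ) ^ r * (k.choose j * (x.coeff k : ℝ))) := by
        intro k
        have h1 := Nat.choose_succ_right_eq k j
        have h2 : (k : ℝ) * k.choose j = (j + 1) * k.choose (j + 1) + j * k.choose j := by
          rcases le_or_gt j k with hjk | hjk
          · have h3 : (k.choose (j + 1) : ℝ) * (j + 1) = k.choose j * (k - j) := by
              rw [← Nat.cast_sub hjk]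
              exact_mod_cast h1
            linarith
          · simp [Nat.choose_eq_zero_of_lt hjk, Nat.choose_eq_zero_of_lt (Nat.lt_succ_of_lt hjk)]
        rw [pow_succ]
        linear_combination (k : ℝ) ^ r * (x.coeff k : ℝ) * h2
      simp only [h]
      exact (hs.mul_left ((j : ℝ) + 1)).add (ht.mul_left (j : ℝ))
    · exact_mod_cast ((isAlgebraic_natCast (R := ℚ) (A := ℝ) (j + 1)).mul hsa).add
        ((isAlgebraic_natCast j).mul hta)

/-- Words of length `n` all of whose proper initial sums are nonpositive. -/
def pendingWords (S : Finset ℤ) (n : ℕ) : Finset (Fin n → S) :=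
  Finset.univ.filter fun w => ∀ j : ℕ, j < n →
    (∑ i ∈ Finset.univ.filter (fun i : Fin n => (i : ℕ) < j), (w i : ℤ)) ≤ 0

/-- Words of length `n` whose walk first becomes positive at its end. -/
def hitWords (S : Finset ℤ) (n : ℕ) : Finset (Fin n → S) :=
  (pendingWords S n).filter fun w => 1 ≤ ∑ i, (w i : ℤ)

/-- Words of length `n` whose walk never becomes positive. -/
def aliveWords (S : Finset ℤ) (n : ℕ) : Finset (Fin n → S) :=
  (pendingWords S n).filter fun w => ¬ 1 ≤ ∑ i, (w i : ℤ)

theorem hitProb_eq (S : Finset ℤ) (p : ℤ → ℚ) (n : ℕ) :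
    hitProb S p n = ∑ w ∈ hitWords S n, ∏ i, p (w i) := by
  rw [hitProb, hitWords, pendingWords, Finset.filter_filter]

theorem mem_pendingWords_snoc {S : Finset ℤ} {n : ℕ} (w : Fin n → S) (s : S) :
    (Fin.snoc w s : Fin (n + 1) → S) ∈ pendingWords S (n + 1) ↔ w ∈ aliveWords S n := by
  have h : ∀ j < n + 1, ∑ i ∈ Finset.univ.filter (fun i : Fin (n + 1) => (i : ℕ) < j),
      ((Fin.snoc w s : Fin (n + 1) → S) i : ℤ) =
        ∑ i ∈ Finset.univ.filter (fun i : Fin n => (i : ℕ) < j), (w i : ℤ) := by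
    intro j hj
    rw [Finset.sum_filter, Finset.sum_filter, Fin.sum_univ_castSucc]
    simp [Nat.not_lt.mpr (Nat.lt_succ_iff.mp hj)]
  have hn : ∑ i ∈ Finset.univ.filter (fun i : Fin n => (i : ℕ) < n), (w i : ℤ) =
      ∑ i, (w i : ℤ) := by simp
  simp only [pendingWords, aliveWords, Finset.mem_filter, Finset.mem_univ, true_and]
  constructor
  · intro hw
    refine ⟨fun j hj => (h j (by omega)).symm.trans_le (hw j (by omega)), ?_⟩
    have := hw n (by omega)
    rw [h n (by omega), hn] at this
    omega
  · rintro ⟨hw, hw'⟩ j hj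
    rw [h j hj]
    rcases Nat.lt_succ_iff_lt_or_eq.mp hj with hj | rfl
    · exact hw j hj
    · rw [hn]
      omega

theorem sum_pendingWords_succ {M : Type*} [AddCommMonoid M] (S : Finset ℤ) (n : ℕ)
    (φ : (Fin (n + 1) → S) → M) :
    ∑ w ∈ pendingWords S (n + 1), φ w =
      ∑ s : S, ∑ w ∈ aliveWords S n, φ (Fin.snoc w s : Fin (n + 1) → S) := by
  have h : ∀ (m : ℕ) (A : Finset (Fin m → S)) (ψ : (Fin m → S) → M),
      ∑ w ∈ A, ψ w = ∑ w, if w ∈ A then ψ w else 0 := fun m A ψ => by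
    rw [← Finset.sum_filter, Finset.filter_univ_mem]
  rw [h, ← (Fin.snocEquiv fun _ => (S : Type)).sum_comp, Fintype.sum_prod_type]
  refine Finset.sum_congr rfl fun s _ => ?_
  rw [h n (aliveWords S n)]
  refine Finset.sum_congr rfl fun w _ => ?_
  exact if_congr (mem_pendingWords_snoc w s) rfl rfl

open LaurentPolynomial in
theorem walk_recurrence (S : Finset ℤ) (p : ℤ → ℚ) (n : ℕ) :
    ∑ w ∈ hitWords S (n + 1), C (∏ i, p (w i)) * T (∑ i, (w i : ℤ)) +
      ∑ w ∈ aliveWords S (n + 1), C (∏ i, p (w i)) * T (∑ i, (w i : ℤ)) =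
    (∑ s ∈ S, C (p s) * T s) *
      ∑ w ∈ aliveWords S n, C (∏ i, p (w i)) * T (∑ i, (w i : ℤ)) := by
  rw [hitWords, aliveWords, Finset.sum_filter_add_sum_filter_not, sum_pendingWords_succ,
    ← Finset.sum_coe_sort S, Finset.sum_mul_sum]
  refine Finset.sum_congr rfl fun s _ => Finset.sum_congr rfl fun w _ => ?_
  simp only [Fin.prod_univ_castSucc, Fin.sum_univ_castSucc, Fin.snoc_castSucc, Fin.snoc_last,
    map_mul, T_add]
  ring

open Polynomial in
/-- The generating polynomial of the overshoot of walks that first become positive at time `n`. -/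
noncomputable def hitPoly (S : Finset ℤ) (p : ℤ → ℚ) (n : ℕ) : ℚ[X] :=
  ∑ w ∈ hitWords S n, C (∏ i, p (w i)) * X ^ (∑ i, (w i : ℤ)).toNat

open Polynomial in
/-- The generating polynomial of the depth at time `n` of walks that have not become positive. -/
noncomputable def alivePoly (S : Finset ℤ) (p : ℤ → ℚ) (n : ℕ) : ℚ[X] :=
  ∑ w ∈ aliveWords S n, C (∏ i, p (w i)) * X ^ (-∑ i, (w i : ℤ)).toNat

open LaurentPolynomial in
theorem toLaurent_hitPoly (S : Finset ℤ) (p : ℤ → ℚ) (n : ℕ) :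
    Polynomial.toLaurent (hitPoly S p n) =
      ∑ w ∈ hitWords S n, C (∏ i, p (w i)) * T (∑ i, (w i : ℤ)) := by
  rw [hitPoly, map_sum]
  refine Finset.sum_congr rfl fun w hw => ?_
  have := (Finset.mem_filter.mp hw).2
  rw [Polynomial.toLaurent_C_mul_X_pow, Int.toNat_of_nonneg (by omega)]

open LaurentPolynomial in
theorem invert_toLaurent_alivePoly (S : Finset ℤ) (p : ℤ → ℚ) (n : ℕ) :
    invert (Polynomial.toLaurent (alivePoly S p n)) =
      ∑ w ∈ aliveWords S n, C (∏ i, p (w i)) * T (∑ i, (w i : ℤ)) := by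
  rw [alivePoly, map_sum, map_sum]
  refine Finset.sum_congr rfl fun w hw => ?_
  have := (Finset.mem_filter.mp hw).2
  rw [Polynomial.toLaurent_C_mul_X_pow, map_mul, invert_C, invert_T,
    Int.toNat_of_nonneg (by omega), neg_neg]

theorem eval_one_hitPoly (S : Finset ℤ) (p : ℤ → ℚ) (n : ℕ) :
    (hitPoly S p n).eval 1 = hitProb S p n := by
  rw [hitPoly, hitProb_eq, Polynomial.eval_finsetSum]
  refine Finset.sum_congr rfl fun w _ => ?_
  rw [Polynomial.eval_mul, Polynomial.eval_C, Polynomial.eval_pow, Polynomial.eval_X, one_pow,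
    mul_one]

theorem hitPoly_zero (S : Finset ℤ) (p : ℤ → ℚ) : hitPoly S p 0 = 0 := by
  simp [hitPoly, hitWords]

theorem alivePoly_zero (S : Finset ℤ) (p : ℤ → ℚ) : alivePoly S p 0 = 1 := by
  simp [alivePoly, aliveWords, pendingWords]

theorem coeff_zero_hitPoly (S : Finset ℤ) (p : ℤ → ℚ) (n : ℕ) : (hitPoly S p n).coeff 0 = 0 := by
  rw [hitPoly, Polynomial.finsetSum_coeff]
  refine Finset.sum_eq_zero fun w hw => ?_
  have := (Finset.mem_filter.mp hw).2
  rw [Polynomial.coeff_C_mul_X_pow, if_neg (by omega)]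

open LaurentPolynomial in
theorem isAlgebraic_mk_hitProb (S : Finset ℤ) (p : ℤ → ℚ) :
    IsAlgebraic (Polynomial ℚ) (PowerSeries.mk (hitProb S p)) := by
  have hab : ∃ d : ℕ, ∀ s ∈ S, s ≤ d ∧ -s ≤ d := by
    refine ⟨∑ s ∈ S, s.natAbs, fun s hs => ?_⟩
    have : s.natAbs ≤ ∑ s ∈ S, s.natAbs :=
      Finset.single_le_sum (f := Int.natAbs) (fun _ _ => Nat.zero_le _) hs
    omega
  obtain ⟨d, hd⟩ := hab
  have key := isAlgebraic_mk_eval_one (f := alivePoly S p) (h := hitPoly S p)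
    (P := ∑ s ∈ S, C (p s) * T s) (a := d) (b := d)
    (Pp := ∑ s ∈ S, Polynomial.C (p s) * Polynomial.X ^ (d + s).toNat)
    (Pm := ∑ s ∈ S, Polynomial.C (p s) * Polynomial.X ^ (d - s).toNat)
    (alivePoly_zero S p) (hitPoly_zero S p) (coeff_zero_hitPoly S p) ?_ ?_ ?_
  · simpa only [eval_one_hitPoly] using key
  · rw [map_sum, Finset.mul_sum]
    refine Finset.sum_congr rfl fun s hs => ?_
    rw [Polynomial.toLaurent_C_mul_X_pow, Int.toNat_of_nonneg (by have := hd s hs; omega), T_add]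
    ring
  · rw [map_sum, map_sum, Finset.mul_sum]
    refine Finset.sum_congr rfl fun s hs => ?_
    rw [Polynomial.toLaurent_C_mul_X_pow, map_mul, invert_C, invert_T,
      Int.toNat_of_nonneg (by have := hd s hs; omega), mul_left_comm, ← T_add]
    congr 2
    ring
  · intro n
    rw [toLaurent_hitPoly, invert_toLaurent_alivePoly, invert_toLaurent_alivePoly,
      walk_recurrence]

theorem hitProb_nonneg (S : Finset ℤ) {p : ℤ → ℚ} (hp : ∀ s ∈ S, 0 < p s) (n : ℕ) :
    0 ≤ hitProb S p n := by
  rw [hitProb_eq]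
  exact Finset.sum_nonneg fun w _ => Finset.prod_nonneg fun i _ => (hp _ (w i).2).le

theorem prod_zpow_eq_zpow_sum {ι K : Type*} [Field K] {x : K} (hx : x ≠ 0) (s : Finset ι)
    (f : ι → ℤ) : ∏ i ∈ s, x ^ f i = x ^ ∑ i ∈ s, f i := by
  classical
  induction s using Finset.induction_on with
  | empty => simp
  | insert a s ha ih => rw [Finset.prod_insert ha, Finset.sum_insert ha, zpow_add₀ hx, ih]

theorem hitProb_succ_le (S : Finset ℤ) {p : ℤ → ℚ} (hp : ∀ s ∈ S, 0 < p s)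
    (hp1 : ∑ s ∈ S, p s = 1) {x : ℝ} (hx : 0 < x) (hx1 : x ≤ 1) (n : ℕ) :
    (hitProb S p (n + 1) : ℝ) ≤ (∑ s ∈ S, (p s : ℝ) * x ^ s) ^ n := by
  have hpR : ∀ s : S, (0 : ℝ) ≤ p s := fun s => by exact_mod_cast (hp s s.2).le
  have hterm : ∀ w : Fin n → S, 0 ≤ ∏ i, (p (w i) : ℝ) := fun w =>
    Finset.prod_nonneg fun i _ => hpR _
  have hsum : ∑ s : S, (p s : ℝ) = 1 := by
    rw [Finset.sum_coe_sort S fun s => (p s : ℝ)]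
    exact_mod_cast hp1
  calc (hitProb S p (n + 1) : ℝ)
      = ∑ w ∈ hitWords S (n + 1), ∏ i, (p (w i) : ℝ) := by rw [hitProb_eq]; push_cast; rfl
    _ ≤ ∑ w ∈ pendingWords S (n + 1), ∏ i, (p (w i) : ℝ) :=
        Finset.sum_le_sum_of_subset_of_nonneg (Finset.filter_subset _ _) fun w _ _ =>
          Finset.prod_nonneg fun i _ => hpR _
    _ = ∑ w ∈ aliveWords S n, ∏ i, (p (w i) : ℝ) := by
        rw [sum_pendingWords_succ]
        simp only [Fin.prod_univ_castSucc, Fin.snoc_castSucc, Fin.snoc_last]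
        simp only [← Finset.sum_mul, ← Finset.mul_sum, hsum, mul_one]
    _ ≤ ∑ w ∈ aliveWords S n, ∏ i, ((p (w i) : ℝ) * x ^ (w i : ℤ)) := by
        refine Finset.sum_le_sum fun w hw => ?_
        have hw' := (Finset.mem_filter.mp hw).2
        rw [Finset.prod_mul_distrib, prod_zpow_eq_zpow_sum hx.ne']
        exact le_mul_of_one_le_right (hterm w) (one_le_zpow_of_nonpos₀ hx hx1 (by omega))
    _ ≤ ∑ w : Fin n → S, ∏ i, ((p (w i) : ℝ) * x ^ (w i : ℤ)) :=
        Finset.sum_le_sum_of_subset_of_nonneg (Finset.subset_univ _) fun w _ _ =>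
          Finset.prod_nonneg fun i _ => mul_nonneg (hpR _) (zpow_nonneg hx.le _)
    _ = (∑ s ∈ S, (p s : ℝ) * x ^ s) ^ n := by
        rw [← Finset.sum_coe_sort S, Fintype.sum_pow]

theorem exists_sum_mul_zpow_lt_one (S : Finset ℤ) {p : ℤ → ℚ} (hp1 : ∑ s ∈ S, p s = 1)
    (hdrift : 0 < ∑ s ∈ S, (s : ℚ) * p s) :
    ∃ x : ℝ, 0 < x ∧ x ≤ 1 ∧ ∑ s ∈ S, (p s : ℝ) * x ^ s < 1 := by
  have hderiv : HasDerivAt (fun x : ℝ => ∑ s ∈ S, (p s : ℝ) * x ^ s)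
      (∑ s ∈ S, (p s : ℝ) * s) 1 := by
    refine HasDerivAt.fun_sum fun s _ => ?_
    simpa using (hasDerivAt_zpow s (1 : ℝ) (Or.inl one_ne_zero)).const_mul (p s : ℝ)
  have hpos : 0 < ∑ s ∈ S, (p s : ℝ) * s := by
    have : (0 : ℝ) < ∑ s ∈ S, (s : ℝ) * p s := by exact_mod_cast hdrift
    simpa only [mul_comm] using this
  have hone : ∑ s ∈ S, (p s : ℝ) * (1 : ℝ) ^ s = 1 := by
    simp only [one_zpow, mul_one]
    exact_mod_cast hp1
  have hslope := (hasDerivAt_iff_tendsto_slope.mp hderiv).eventually (lt_mem_nhds hpos)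
  have hleft := hslope.filter_mono (nhdsWithin_mono (1 : ℝ) (s := Set.Iio 1) fun y hy => ne_of_lt hy)
  obtain ⟨x, hx, h0, h1⟩ :=
    (hleft.and (Ioo_mem_nhdsLT (zero_lt_one : (0 : ℝ) < 1))).exists
  refine ⟨x, h0, h1.le, ?_⟩
  rw [slope_def_field, hone] at hx
  rcases div_pos_iff.mp hx with ⟨-, h⟩ | ⟨h, -⟩ <;> linarith

theorem mk_hitProb_mem_reexpansion (S : Finset ℤ) {p : ℤ → ℚ} (hp : ∀ s ∈ S, 0 < p s)
    (hp1 : ∑ s ∈ S, p s = 1) (hdrift : 0 < ∑ s ∈ S, (s : ℚ) * p s) :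
    (PowerSeries.mk (hitProb S p),
      PowerSeries.mk fun j => ∑' k : ℕ, (k.choose j : ℝ) * (hitProb S p k : ℝ)) ∈ reexpansion := by
  intro j
  simp only [PowerSeries.coeff_mk]
  refine ⟨?_, trivial⟩
  obtain ⟨x, hx, hx1, hlt⟩ := exists_sum_mul_zpow_lt_one S hp1 hdrift
  set ρ := ∑ s ∈ S, (p s : ℝ) * x ^ s
  have hρ : 0 ≤ ρ := Finset.sum_nonneg fun s hs =>
    mul_nonneg (by exact_mod_cast (hp s hs).le) (zpow_nonneg hx.le _)
  have hnn : ∀ k, (0 : ℝ) ≤ hitProb S p k := fun k => by exact_mod_cast hitProb_nonneg S hp k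
  have hgeom : Summable fun n : ℕ => ((n + j).choose j : ℝ) * ρ ^ n :=
    summable_choose_mul_geometric_of_norm_lt_one j (by rwa [Real.norm_of_nonneg hρ])
  rw [← summable_nat_add_iff 1]
  rcases j with _ | j
  · refine hgeom.of_nonneg_of_le (fun n => norm_nonneg _) fun n => ?_
    rw [Real.norm_of_nonneg (mul_nonneg (Nat.cast_nonneg _) (hnn _))]
    simpa using hitProb_succ_le S hp hp1 hx hx1 n
  · refine hgeom.of_nonneg_of_le (fun n => norm_nonneg _) fun n => ?_
    rw [Real.norm_of_nonneg (mul_nonneg (Nat.cast_nonneg _) (hnn _))]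
    refine mul_le_mul ?_ (hitProb_succ_le S hp hp1 hx hx1 n) (hnn _) (Nat.cast_nonneg _)
    exact_mod_cast Nat.choose_le_choose _ (by omega)

/-- For any die on nonzero integers with rational probabilities and positive
drift, all the moments `Σ_k k^r·a(k)` of the first-passage time to a strictly positive
position converge and are real algebraic numbers over ℚ. -/
theorem first_passage_moments_are_algebraic (S : Finset ℤ) (hS : 0 ∉ S)
    (p : ℤ → ℚ) (hp : ∀ s ∈ S, 0 < p s) (hp1 : ∑ s ∈ S, p s = 1)
    (hdrift : 0 < ∑ s ∈ S, (s : ℚ) * p s) :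
    ∀ r : ℕ, 1 ≤ r → ∃ x : ℝ,
      HasSum (fun k : ℕ => (k : ℝ) ^ r * (hitProb S p k : ℝ)) x ∧ IsAlgebraic ℚ x := by
  intro r _
  simpa only [PowerSeries.coeff_mk] using exists_hasSum_isAlgebraic_of_mem_reexpansion
    (mk_hitProb_mem_reexpansion S hp hp1 hdrift) (isAlgebraic_mk_hitProb S p) r
end

section
/- Fix a real number p with 0 < p < 1 and consider the positive-step die with face values 1 and 2 having probabilities p and 1−p respectively; let E(n) be the expected duration until the running total first reaches ≥ n. Then E(n) − ( n/(2−p) + (1−p)/(2−p)² ) tends to 0 as n → ∞. -/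
/-- The first-passage probability `P_n(k)`: the probability that the running total of
rolls of the die (face values `v`, probabilities `p`) first reaches `≥ n` at exactly
roll `k`. -/
noncomputable def firstPassage {s : ℕ} (v : Fin s → ℕ) (p : Fin s → ℝ) (n k : ℕ) : ℝ :=
  ∑ w ∈ Finset.univ.filter (fun w : Fin k → Fin s =>
      n ≤ prefSumN v w k ∧ ∀ j : ℕ, j < k → prefSumN v w j < n),
    ∏ i : Fin k, p (w i)

/-- The expected duration `E(n) = Σ_{k=1}^n k · P_n(k)` until first reaching `≥ n`. -/
noncomputable def expDur {s : ℕ} (v : Fin s → ℕ) (p : Fin s → ℝ) (n : ℕ) : ℝ :=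
  ∑ k ∈ Finset.Icc 1 n, (k : ℝ) * firstPassage v p n k

lemma prefSumN_zero {s k : ℕ} (v : Fin s → ℕ) (w : Fin k → Fin s) : prefSumN v w 0 = 0 := by
  simp [prefSumN]

lemma prefSumN_cons_succ {s k : ℕ} (v : Fin s → ℕ) (a : Fin s) (w : Fin k → Fin s) (j : ℕ) :
    prefSumN v (Fin.cons a w : Fin (k + 1) → Fin s) (j + 1) = v a + prefSumN v w j := by
  simp [prefSumN, Finset.sum_filter, Fin.sum_univ_succ]

lemma firstPassage_zero_zero {s : ℕ} (v : Fin s → ℕ) (p : Fin s → ℝ) :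
    firstPassage v p 0 0 = 1 := by
  simp [firstPassage]

lemma firstPassage_zero_succ {s : ℕ} (v : Fin s → ℕ) (p : Fin s → ℝ) (k : ℕ) :
    firstPassage v p 0 (k + 1) = 0 := by
  rw [firstPassage, Finset.filter_false_of_mem, Finset.sum_empty]
  rintro w - ⟨-, h⟩
  exact Nat.not_lt_zero _ (h 0 k.succ_pos)

lemma firstPassage_succ_zero {s : ℕ} (v : Fin s → ℕ) (p : Fin s → ℝ) (n : ℕ) :
    firstPassage v p (n + 1) 0 = 0 := by
  simp [firstPassage, prefSumN_zero]

/-- Conditioning on the first roll. -/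
lemma firstPassage_succ {s : ℕ} (v : Fin s → ℕ) (p : Fin s → ℝ) {n : ℕ} (hn : 0 < n) (k : ℕ) :
    firstPassage v p n (k + 1) = ∑ a, p a * firstPassage v p (n - v a) k := by
  simp only [firstPassage, Finset.sum_filter]
  rw [← (Fin.consEquiv (fun _ : Fin (k + 1) => Fin s)).sum_comp, Fintype.sum_prod_type]
  refine Finset.sum_congr rfl fun a _ => ?_
  rw [Finset.mul_sum]
  refine Finset.sum_congr rfl fun w _ => ?_
  have h : (n ≤ prefSumN v (Fin.cons a w : Fin (k + 1) → Fin s) (k + 1) ∧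
      ∀ j < k + 1, prefSumN v (Fin.cons a w : Fin (k + 1) → Fin s) j < n) ↔
      (n - v a ≤ prefSumN v w k ∧ ∀ j < k, prefSumN v w j < n - v a) := by
    rw [prefSumN_cons_succ]
    refine and_congr (by omega) ⟨fun h j hj => ?_, fun h j hj => ?_⟩
    · have := h (j + 1) (by omega)
      rw [prefSumN_cons_succ] at this
      omega
    · cases j with
      | zero => rwa [prefSumN_zero]
      | succ j =>
        have := h j (by omega)
        rw [prefSumN_cons_succ]
        omega
  simp only [Fin.consEquiv, Equiv.coe_fn_mk, h, Fin.prod_univ_succ, Fin.cons_zero, Fin.cons_succ,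
    mul_ite, mul_zero]

lemma sum_firstPassage_succ {s : ℕ} (v : Fin s → ℕ) (p : Fin s → ℝ) {n : ℕ} (hn : 0 < n)
    (N : ℕ) :
    ∑ k ∈ Finset.range (N + 1), firstPassage v p n k =
      ∑ a, p a * ∑ k ∈ Finset.range N, firstPassage v p (n - v a) k := by
  obtain ⟨n, rfl⟩ := Nat.exists_eq_succ_of_ne_zero hn.ne'
  simp only [Finset.sum_range_succ', firstPassage_succ_zero, add_zero, firstPassage_succ v p hn,
    Finset.mul_sum]
  exact Finset.sum_comm

lemma sum_firstPassage_eq_one {s : ℕ} {v : Fin s → ℕ} {p : Fin s → ℝ} (hv : ∀ a, 0 < v a)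
    (hp : ∑ a, p a = 1) {n N : ℕ} (h : n < N) :
    ∑ k ∈ Finset.range N, firstPassage v p n k = 1 := by
  induction N generalizing n with
  | zero => omega
  | succ N ih =>
    rcases Nat.eq_zero_or_pos n with rfl | hn
    · simp [Finset.sum_range_succ', firstPassage_zero_zero, firstPassage_zero_succ]
    · rw [sum_firstPassage_succ v p hn, ← hp]
      refine Finset.sum_congr rfl fun a _ => ?_
      rw [ih (by have := hv a; omega), mul_one]

lemma sum_mul_firstPassage_succ {s : ℕ} {v : Fin s → ℕ} {p : Fin s → ℝ} (hv : ∀ a, 0 < v a)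
    (hp : ∑ a, p a = 1) {n N : ℕ} (hn : 0 < n) (h : n ≤ N) :
    ∑ k ∈ Finset.range (N + 1), (k : ℝ) * firstPassage v p n k =
      1 + ∑ a, p a * ∑ k ∈ Finset.range N, (k : ℝ) * firstPassage v p (n - v a) k := by
  have hone : ∑ k ∈ Finset.range N, firstPassage v p n (k + 1) = 1 := by
    rw [← sum_firstPassage_eq_one hv hp (Nat.lt_succ_of_le h), Finset.sum_range_succ']
    obtain ⟨n, rfl⟩ := Nat.exists_eq_succ_of_ne_zero hn.ne'
    simp [firstPassage_succ_zero]
  simp only [Finset.sum_range_succ', Nat.cast_zero, zero_mul, add_zero, Nat.cast_succ, add_mul,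
    one_mul, Finset.sum_add_distrib, hone]
  rw [add_comm]
  congr 1
  simp only [firstPassage_succ v p hn, Finset.mul_sum]
  rw [Finset.sum_comm]
  exact Finset.sum_congr rfl fun _ _ => Finset.sum_congr rfl fun _ _ => mul_left_comm _ _ _

lemma sum_mul_firstPassage_coin {p : ℝ} (hp : 2 - p ≠ 0) {n N : ℕ} (h : n < N) :
    ∑ k ∈ Finset.range N, (k : ℝ) * firstPassage ![1, 2] ![p, 1 - p] n k =
      n / (2 - p) + (1 - p) / (2 - p) ^ 2 - (1 - p) / (2 - p) ^ 2 * (p - 1) ^ n := by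
  induction N using Nat.strong_induction_on generalizing n with
  | _ N ih =>
    obtain ⟨N, rfl⟩ := Nat.exists_eq_succ_of_ne_zero (Nat.ne_zero_of_lt h)
    rcases Nat.eq_zero_or_pos n with rfl | hn
    · simp [Finset.sum_range_succ', firstPassage_zero_succ]
    · rw [Nat.succ_eq_add_one, sum_mul_firstPassage_succ (by simp [Fin.forall_fin_two]) (by simp)
        hn (by omega)]
      simp only [Fin.sum_univ_two, Matrix.cons_val_zero, Matrix.cons_val_one]
      rw [ih N (by omega) (by omega), ih N (by omega) (by omega)]
      rcases n with _ | _ | n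
      · omega
      · simp
        field_simp
        ring
      · simp only [Nat.add_sub_cancel, show n + 1 + 1 - 2 = n by omega]
        push_cast
        field_simp
        ring

lemma expDur_eq_sum_range {s : ℕ} (v : Fin s → ℕ) (p : Fin s → ℝ) (n : ℕ) :
    expDur v p n = ∑ k ∈ Finset.range (n + 1), (k : ℝ) * firstPassage v p n k := by
  refine Finset.sum_subset (fun k hk => ?_) fun k hk hk' => ?_
  · simp only [Finset.mem_Icc, Finset.mem_range] at *
    omega
  · simp only [Finset.mem_Icc, Finset.mem_range] at *
    simp [show k = 0 by omega]

/-- For the die with faces 1 and 2 of probabilities p and 1−p, the expected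
duration `E(n)` satisfies `E(n) − (n/(2−p) + (1−p)/(2−p)²) → 0` as `n → ∞`. -/
theorem expected_duration_loaded_coin (p : ℝ) (hp0 : 0 < p) (hp1 : p < 1) :
    Filter.Tendsto
      (fun n : ℕ => expDur ![1, 2] ![p, 1 - p] n - ((n : ℝ) / (2 - p) + (1 - p) / (2 - p) ^ 2))
      Filter.atTop (nhds 0) := by
  have hlim : Filter.Tendsto (fun n : ℕ => -((1 - p) / (2 - p) ^ 2 * (p - 1) ^ n))
      Filter.atTop (nhds 0) := by
    simpa using ((tendsto_pow_atTop_nhds_zero_of_abs_lt_one (r := p - 1)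
      (abs_lt.2 ⟨by linarith, by linarith⟩)).const_mul ((1 - p) / (2 - p) ^ 2)).neg
  refine hlim.congr fun n => ?_
  rw [expDur_eq_sum_range, sum_mul_firstPassage_coin (by linarith) n.lt_succ_self]
  ring
end
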